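/- arXiv:2304.10052 — 2 statements merged into one kernel-verified Lean document; each statement's English description precedes it below -/
import Mathlib

section
/- (Minimum Φ-distance estimator, local uniform bound.) Fix 1 ≤ k0 ≤ k with d1 = k − k0 + 1 and G0 ∈ E_{k0}(Θ). Suppose Θ ⊆ ℝ^q is compact, every φ ∈ Φ is continuous on Θ, G_k(Θ) is distinguishable by Φ, and the local inverse bound holds at G0: there exist r0 > 0 and c0 > 0 such that sup_{φ∈Φ}|Gφ − Hφ| ≥ c0 · W_{2d1−1}(G,H)^{2d1−1} whenever G ≠ H ∈ G_k(Θ) satisfy W_1(G,G0) ≤ r0 and W_1(H,G0) ≤ r0. Then there exist r > 0 and C > 0 such that: for every G* ∈ G_k(Θ) with W_1(G0,G*) < r, every function T : Φ → ℝ (playing the role of the empirical averages φ ↦ (1/n)Σ_{i=1}^n t_φ(X_i)), and every Ĝ ∈ G_k(Θ) satisfying sup_{φ∈Φ}|Ĝφ − T(φ)| ≤ sup_{φ∈Φ}|G'φ − T(φ)| for all G' ∈ G_k(Θ) (i.e., Ĝ is a minimum Φ-distance estimate for the data summary T), and every t > 0: if W_{2d1−1}(G*,Ĝ)^{2d1−1}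 ≥ t then sup_{φ∈Φ}|T(φ) − G*φ| ≥ C · min(t,1). -/
open scoped BigOperators ENNReal

noncomputable section

abbrev Euc (q : ℕ) : Type := EuclideanSpace ℝ (Fin q)

def IsMixingMeasure {q : ℕ} (Θ : Set (Euc q)) (G : Euc q →₀ ℝ) : Prop :=
  (∀ x ∈ G.support, 0 < G x) ∧ (∑ x ∈ G.support, G x) = 1 ∧ ↑G.support ⊆ Θ

/-- `E_k(Θ)`: discrete probability measures on `Θ` with exactly `k` atoms. -/
def MixE {q : ℕ} (Θ : Set (Euc q)) (k : ℕ) (G : Euc q →₀ ℝ) : Prop :=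
  IsMixingMeasure Θ G ∧ G.support.card = k

/-- `G_k(Θ)`: discrete probability measures on `Θ` with at most `k` atoms. -/
def MixG {q : ℕ} (Θ : Set (Euc q)) (k : ℕ) (G : Euc q →₀ ℝ) : Prop :=
  IsMixingMeasure Θ G ∧ G.support.card ≤ k

/-- `Gφ = ∑ᵢ pᵢ φ(θᵢ)`. -/
def mixInt {q : ℕ} (G : Euc q →₀ ℝ) (φ : Euc q → ℝ) : ℝ :=
  ∑ x ∈ G.support, G x * φ x

def IsCoupling {q : ℕ} (G H : Euc q →₀ ℝ) (π : Euc q × Euc q → ℝ) : Prop :=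
  (∀ p, 0 ≤ π p) ∧
  (∀ x ∈ G.support, (∑ y ∈ H.support, π (x, y)) = G x) ∧
  (∀ y ∈ H.support, (∑ x ∈ G.support, π (x, y)) = H y)

/-- `Wpow ℓ G H = W_ℓ(G,H)^ℓ`, the minimal transport cost with cost `‖θ-θ'‖^ℓ`. -/
def Wpow {q : ℕ} (ℓ : ℝ) (G H : Euc q →₀ ℝ) : ℝ :=
  sInf { c | ∃ π : Euc q × Euc q → ℝ, IsCoupling G H π ∧
    c = ∑ p ∈ G.support ×ˢ H.support, π p * ‖p.1 - p.2‖ ^ ℓ }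

/-- `sup_{φ ∈ Φ} |Gφ - Hφ|`, valued in `ℝ≥0∞`. -/
def phiDist {q : ℕ} (Φ : Set (Euc q → ℝ)) (G H : Euc q →₀ ℝ) : ℝ≥0∞ :=
  ⨆ φ ∈ Φ, ENNReal.ofReal |mixInt G φ - mixInt H φ|

/-- Multi-indices `α ∈ ℕ^q` with `|α| ≤ n`, as a finite set. -/
def multiIdx (q n : ℕ) : Finset (Fin q → ℕ) :=
  (Fintype.piFinset fun _ : Fin q => Finset.range (n + 1)).filter fun α => (∑ j, α j) ≤ n

def pderivSeq {q : ℕ} : List (Fin q) → (Euc q → ℝ) → (Euc q → ℝ)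
  | [], f => f
  | i :: l, f => pderivSeq l fun x => fderiv ℝ f x (EuclideanSpace.single i 1)

/-- The partial derivative `D^α` of multi-order `α`. -/
def Dmulti {q : ℕ} (α : Fin q → ℕ) (f : Euc q → ℝ) : Euc q → ℝ :=
  pderivSeq ((List.finRange q).flatMap fun i => List.replicate (α i) i) f


/-- `sup_{φ ∈ Φ} |Gφ - T(φ)|`, where `T` is a data summary (e.g. empirical averages). -/
def phiDistT {q : ℕ} (Φ : Set (Euc q → ℝ)) (G : Euc q →₀ ℝ) (T : (Euc q → ℝ) → ℝ) : ℝ≥0∞ :=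
  ⨆ φ ∈ Φ, ENNReal.ofReal |mixInt G φ - T φ|

section Transport

variable {q : ℕ}

lemma mixInt_eq_linearCombination (G : Euc q →₀ ℝ) (φ : Euc q → ℝ) :
    mixInt G φ = Finsupp.linearCombination ℝ φ G := by
  simp [Finsupp.linearCombination_apply, Finsupp.sum, mixInt]

lemma IsCoupling.swap {G H : Euc q →₀ ℝ} {π : Euc q × Euc q → ℝ} (h : IsCoupling G H π) :
    IsCoupling H G (fun p => π p.swap) :=
  ⟨fun _ => h.1 _, h.2.2, h.2.1⟩

lemma Wpow_le_cost {ℓ : ℝ} {G H : Euc q →₀ ℝ} {π : Euc q × Euc q → ℝ} (h : IsCoupling G H π) :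
    Wpow ℓ G H ≤ ∑ p ∈ G.support ×ˢ H.support, π p * ‖p.1 - p.2‖ ^ ℓ := by
  refine csInf_le ⟨0, ?_⟩ ⟨π, h, rfl⟩
  rintro c ⟨π', h', rfl⟩
  exact Finset.sum_nonneg fun p _ => mul_nonneg (h'.1 p) (Real.rpow_nonneg (norm_nonneg _) _)

lemma Wpow_comm (ℓ : ℝ) (G H : Euc q →₀ ℝ) : Wpow ℓ G H = Wpow ℓ H G := by
  have key : ∀ G H : Euc q →₀ ℝ, ∀ c : ℝ, (∃ π : Euc q × Euc q → ℝ, IsCoupling G H π ∧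
      c = ∑ p ∈ G.support ×ˢ H.support, π p * ‖p.1 - p.2‖ ^ ℓ) →
      ∃ π : Euc q × Euc q → ℝ, IsCoupling H G π ∧
      c = ∑ p ∈ H.support ×ˢ G.support, π p * ‖p.1 - p.2‖ ^ ℓ := by
    rintro G H c ⟨π, h, rfl⟩
    refine ⟨_, h.swap, ?_⟩
    rw [Finset.sum_product, Finset.sum_product_right]
    simp [norm_sub_rev]
  unfold Wpow
  congr 1
  ext c
  exact ⟨key G H c, key H G c⟩

lemma Wpow_self {ℓ : ℝ} (hℓ : ℓ ≠ 0) {G : Euc q →₀ ℝ} (hG : ∀ x ∈ G.support, 0 < G x) :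
    Wpow ℓ G G ≤ 0 := by
  classical
  have h : IsCoupling G G (fun p => if p.1 = p.2 then G p.1 else 0) := by
    refine ⟨fun p => ?_, fun x hx => ?_, fun x hx => ?_⟩
    · dsimp only
      split_ifs
      · by_cases hp : p.1 ∈ G.support
        · exact (hG _ hp).le
        · rw [Finsupp.notMem_support_iff.1 hp]
      · rfl
    · rw [Finset.sum_ite_eq, if_pos hx]
    · rw [Finset.sum_ite_eq', if_pos hx]
  refine (Wpow_le_cost h).trans (Finset.sum_nonpos fun p _ => ?_)
  split_ifs with hp
  · simp [hp, Real.zero_rpow hℓ]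
  · simp

lemma exists_isCoupling {Θ : Set (Euc q)} {G H : Euc q →₀ ℝ} (hG : IsMixingMeasure Θ G)
    (hH : IsMixingMeasure Θ H) : ∃ π : Euc q × Euc q → ℝ, IsCoupling G H π := by
  have nn : ∀ {G : Euc q →₀ ℝ}, IsMixingMeasure Θ G → ∀ x, 0 ≤ G x := by
    intro G hG x
    by_cases hx : x ∈ G.support
    · exact (hG.1 x hx).le
    · rw [Finsupp.notMem_support_iff.1 hx]
  refine ⟨fun p => G p.1 * H p.2, fun p => mul_nonneg (nn hG _) (nn hH _), fun x _ => ?_,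
    fun y _ => ?_⟩
  · simp only [← Finset.mul_sum, hH.2.1, mul_one]
  · simp only [← Finset.sum_mul, hG.2.1, one_mul]

lemma abs_mixInt_sub_le {Θ : Set (Euc q)} {G H : Euc q →₀ ℝ} (hG : IsMixingMeasure Θ G)
    (hH : IsMixingMeasure Θ H) {φ : Euc q → ℝ} {ε M : ℝ} (hM : 0 < M)
    (hφ : ∀ x ∈ Θ, ∀ y ∈ Θ, |φ x - φ y| ≤ ε + M * ‖x - y‖) :
    |mixInt G φ - mixInt H φ| ≤ ε + M * Wpow 1 G H := by
  suffices h : (|mixInt G φ - mixInt H φ| - ε) / M ≤ Wpow 1 G H by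
    rw [div_le_iff₀ hM] at h
    linarith
  obtain ⟨π₀, h₀⟩ := exists_isCoupling hG hH
  refine le_csInf ⟨_, π₀, h₀, rfl⟩ ?_
  rintro c ⟨π, hπ, rfl⟩
  rw [div_le_iff₀ hM]
  have e1 : mixInt G φ = ∑ p ∈ G.support ×ˢ H.support, π p * φ p.1 := by
    rw [Finset.sum_product]
    refine Finset.sum_congr rfl fun x hx => ?_
    rw [← hπ.2.1 x hx, Finset.sum_mul]
  have e2 : mixInt H φ = ∑ p ∈ G.support ×ˢ H.support, π p * φ p.2 := by
    rw [Finset.sum_product_right]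
    refine Finset.sum_congr rfl fun x hx => ?_
    rw [← hπ.2.2 x hx, Finset.sum_mul]
  have e3 : ∑ p ∈ G.support ×ˢ H.support, π p = 1 := by
    rw [Finset.sum_product, ← hG.2.1]
    exact Finset.sum_congr rfl hπ.2.1
  have e4 : |mixInt G φ - mixInt H φ| ≤
      ∑ p ∈ G.support ×ˢ H.support, (π p * ε + π p * ‖p.1 - p.2‖ ^ (1 : ℝ) * M) := by
    rw [e1, e2, ← Finset.sum_sub_distrib]
    refine (Finset.abs_sum_le_sum_abs _ _).trans (Finset.sum_le_sum fun p hp => ?_)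
    rw [Finset.mem_product] at hp
    rw [← mul_sub, abs_mul, abs_of_nonneg (hπ.1 p), Real.rpow_one]
    have := mul_le_mul_of_nonneg_left
      (hφ _ (hG.2.2 hp.1) _ (hH.2.2 hp.2)) (hπ.1 p)
    linarith
  rw [Finset.sum_add_distrib, ← Finset.sum_mul, ← Finset.sum_mul, e3] at e4
  linarith

/-- A continuous function on a compact set is Lipschitz up to an arbitrarily small additive
error. -/
lemma exists_abs_sub_le_add_mul_norm {Θ : Set (Euc q)} (hΘ : IsCompact Θ) {φ : Euc q → ℝ}
    (hφ : ContinuousOn φ Θ) {ε : ℝ} (hε : 0 < ε) :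
    ∃ M > 0, ∀ x ∈ Θ, ∀ y ∈ Θ, |φ x - φ y| ≤ ε + M * ‖x - y‖ := by
  obtain ⟨δ, hδ, h⟩ := Metric.uniformContinuousOn_iff.1
    (hΘ.uniformContinuousOn_of_continuous hφ) ε hε
  obtain ⟨B, hB⟩ := hΘ.exists_bound_of_continuousOn hφ
  refine ⟨2 * (|B| + 1) / δ, by positivity, fun x hx y hy => ?_⟩
  rcases lt_or_ge (dist x y) δ with hd | hd
  · have h1 := (h x hx y hy hd).le
    rw [Real.dist_eq] at h1
    have : 0 ≤ 2 * (|B| + 1) / δ * ‖x - y‖ := by positivity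
    linarith
  · rw [dist_eq_norm] at hd
    have h1 : 2 * (|B| + 1) / δ * δ ≤ 2 * (|B| + 1) / δ * ‖x - y‖ := by gcongr
    rw [div_mul_cancel₀ _ hδ.ne'] at h1
    have h2 := abs_sub (φ x) (φ y)
    have h3 := hB x hx
    have h4 := hB y hy
    rw [Real.norm_eq_abs] at h3 h4
    have := le_abs_self B
    linarith

end Transport

section Atomic

variable {q : ℕ} {ι : Type*} [Fintype ι]

/-- The finitely supported measure `∑ᵢ aᵢ δ_{xᵢ}`, where the `xᵢ` may repeat. -/
def atomicMeasure (a : ι → ℝ) (x : ι → Euc q) : Euc q →₀ ℝ :=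
  ∑ i, Finsupp.single (x i) (a i)

lemma mixInt_atomicMeasure (a : ι → ℝ) (x : ι → Euc q) (φ : Euc q → ℝ) :
    mixInt (atomicMeasure a x) φ = ∑ i, a i * φ (x i) := by
  simp [mixInt_eq_linearCombination, atomicMeasure]

open Classical in
lemma atomicMeasure_apply (a : ι → ℝ) (x : ι → Euc q) (u : Euc q) :
    atomicMeasure a x u = ∑ i, if x i = u then a i else 0 := by
  simp [atomicMeasure, Finsupp.finsetSum_apply, Finsupp.single_apply]

lemma mem_support_atomicMeasure {a : ι → ℝ} {x : ι → Euc q} (ha : ∀ i, 0 ≤ a i) {i : ι}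
    (hi : a i ≠ 0) : x i ∈ (atomicMeasure a x).support := by
  classical
  rw [Finsupp.mem_support_iff, atomicMeasure_apply]
  refine (Finset.sum_pos' (fun j _ => ?_) ⟨i, Finset.mem_univ i, ?_⟩).ne'
  · split_ifs
    exacts [ha j, le_rfl]
  · rw [if_pos rfl]
    exact lt_of_le_of_ne (ha i) hi.symm

lemma exists_of_mem_support_atomicMeasure {a : ι → ℝ} {x : ι → Euc q} {u : Euc q}
    (hu : u ∈ (atomicMeasure a x).support) : ∃ i, x i = u := by
  classical
  by_contra! h
  rw [Finsupp.mem_support_iff, atomicMeasure_apply] at hu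
  exact hu (Finset.sum_eq_zero fun i _ => if_neg (h i))

lemma isMixingMeasure_atomicMeasure {Θ : Set (Euc q)} {a : ι → ℝ} {x : ι → Euc q}
    (ha : a ∈ stdSimplex ℝ ι) (hx : ∀ i, x i ∈ Θ) : IsMixingMeasure Θ (atomicMeasure a x) := by
  classical
  refine ⟨fun u hu => lt_of_le_of_ne ?_ (Finsupp.mem_support_iff.1 hu).symm, ?_, fun u hu => ?_⟩
  · rw [atomicMeasure_apply]
    refine Finset.sum_nonneg fun j _ => ?_
    split_ifs
    exacts [ha.1 j, le_rfl]
  · have := mixInt_atomicMeasure a x (fun _ => 1)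
    simpa [mixInt, ha.2] using this
  · obtain ⟨i, rfl⟩ := exists_of_mem_support_atomicMeasure hu
    exact hx i

lemma card_support_atomicMeasure_le (a : ι → ℝ) (x : ι → Euc q) :
    (atomicMeasure a x).support.card ≤ Fintype.card ι := by
  classical
  refine (Finset.card_le_card (t := Finset.univ.image x) fun u hu => ?_).trans
    Finset.card_image_le
  obtain ⟨i, rfl⟩ := exists_of_mem_support_atomicMeasure hu
  exact Finset.mem_image_of_mem _ (Finset.mem_univ i)

lemma exists_eq_atomicMeasure {Θ : Set (Euc q)} {k : ℕ} {G : Euc q →₀ ℝ} (hG : MixG Θ k G) :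
    ∃ a ∈ stdSimplex ℝ (Fin k), ∃ x : Fin k → Euc q, (∀ i, x i ∈ Θ) ∧ G = atomicMeasure a x := by
  obtain ⟨e⟩ : Nonempty (G.support ↪ Fin k) :=
    Function.Embedding.nonempty_of_card_le (by simpa using hG.2)
  obtain ⟨x₀, hx₀⟩ : G.support.Nonempty := by
    rw [Finset.nonempty_iff_ne_empty]
    intro h
    have := hG.1.2.1
    rw [h, Finset.sum_empty] at this
    exact zero_ne_one this
  set a : Fin k → ℝ := Function.extend e (fun x => G x) 0 with ha
  set x : Fin k → Euc q := Function.extend e (fun x => (x : Euc q)) (fun _ => x₀) with hx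
  have hae : ∀ u, a (e u) = G u := fun u => e.injective.extend_apply _ _ u
  have hxe : ∀ u, x (e u) = u := fun u => e.injective.extend_apply _ _ u
  have ha0 : ∀ i, i ∉ Set.range e → a i = 0 := fun i hi => Function.extend_apply' _ _ _ hi
  have hx0 : ∀ i, i ∉ Set.range e → x i = x₀ := fun i hi => Function.extend_apply' _ _ _ hi
  refine ⟨a, ⟨fun i => ?_, ?_⟩, x, fun i => ?_, ?_⟩
  · by_cases hi : i ∈ Set.range e
    · obtain ⟨u, rfl⟩ := hi
      rw [hae]
      exact (hG.1.1 _ u.2).le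
    · rw [ha0 i hi]
  · rw [← Fintype.sum_of_injective e e.injective (fun u => G u) a ha0 fun u => (hae u).symm,
      ← hG.1.2.1, Finset.sum_coe_sort G.support (fun u => G u)]
  · by_cases hi : i ∈ Set.range e
    · obtain ⟨u, rfl⟩ := hi
      rw [hxe]
      exact hG.1.2.2 u.2
    · rw [hx0 i hi]
      exact hG.1.2.2 hx₀
  · rw [atomicMeasure, ← Fintype.sum_of_injective e e.injective
      (fun u => Finsupp.single (u : Euc q) (G u)) _
      (fun i hi => by rw [ha0 i hi, Finsupp.single_zero])
      fun u => by rw [hae, hxe], Finset.sum_coe_sort G.support (fun u => Finsupp.single u (G u))]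
    exact G.sum_single.symm

open Classical in
/-- The push-forward of a matrix of masses to pairs of points. -/
def pushCoupling (x y : ι → Euc q) (m : ι → ι → ℝ) (p : Euc q × Euc q) : ℝ :=
  ∑ i, ∑ j, if x i = p.1 ∧ y j = p.2 then m i j else 0

lemma sum_pushCoupling_left {a b : ι → ℝ} {x y : ι → Euc q} {m : ι → ι → ℝ}
    (hm : ∀ i j, 0 ≤ m i j) (hrow : ∀ i, ∑ j, m i j = a i) (hcol : ∀ j, ∑ i, m i j = b j)
    (u : Euc q) :
    ∑ v ∈ (atomicMeasure b y).support, pushCoupling x y m (u, v) = atomicMeasure a x u := by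
  classical
  have hb : ∀ j, 0 ≤ b j := fun j => hcol j ▸ Finset.sum_nonneg fun i _ => hm i j
  simp only [pushCoupling]
  rw [Finset.sum_comm, atomicMeasure_apply]
  refine Finset.sum_congr rfl fun i _ => ?_
  rw [Finset.sum_comm]
  by_cases hi : x i = u
  · rw [if_pos hi, ← hrow]
    refine Finset.sum_congr rfl fun j _ => ?_
    simp only [hi, true_and, Finset.sum_ite_eq]
    split_ifs with hj
    · rfl
    · by_contra h
      refine hj (mem_support_atomicMeasure hb fun hbj => h ?_)
      rw [← hcol, Finset.sum_eq_zero_iff_of_nonneg fun i _ => hm i j] at hbj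
      exact (hbj i (Finset.mem_univ i)).symm
  · simp [hi]

lemma isCoupling_pushCoupling {a b : ι → ℝ} {x y : ι → Euc q} {m : ι → ι → ℝ}
    (hm : ∀ i j, 0 ≤ m i j) (hrow : ∀ i, ∑ j, m i j = a i) (hcol : ∀ j, ∑ i, m i j = b j) :
    IsCoupling (atomicMeasure a x) (atomicMeasure b y) (pushCoupling x y m) := by
  classical
  refine ⟨fun p => ?_, fun u _ => sum_pushCoupling_left hm hrow hcol u, fun v _ => ?_⟩
  · refine Finset.sum_nonneg fun i _ => Finset.sum_nonneg fun j _ => ?_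
    split_ifs
    exacts [hm i j, le_rfl]
  · rw [← sum_pushCoupling_left (x := y) (y := x) (m := fun i j => m j i)
      (fun i j => hm j i) hcol hrow v]
    refine Finset.sum_congr rfl fun u _ => ?_
    simp only [pushCoupling]
    rw [Finset.sum_comm]
    simp only [and_comm]

lemma Wpow_atomicMeasure_le {ℓ : ℝ} {a b : ι → ℝ} {x y : ι → Euc q} {m : ι → ι → ℝ}
    (hm : ∀ i j, 0 ≤ m i j) (hrow : ∀ i, ∑ j, m i j = a i) (hcol : ∀ j, ∑ i, m i j = b j) :
    Wpow ℓ (atomicMeasure a x) (atomicMeasure b y) ≤ ∑ i, ∑ j, m i j * ‖x i - y j‖ ^ ℓ := by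
  classical
  refine (Wpow_le_cost (isCoupling_pushCoupling hm hrow hcol)).trans ?_
  simp only [pushCoupling, Finset.sum_mul]
  rw [Finset.sum_comm]
  refine Finset.sum_le_sum fun i _ => ?_
  rw [Finset.sum_comm]
  refine Finset.sum_le_sum fun j _ => ?_
  have hnn : 0 ≤ m i j * ‖x i - y j‖ ^ ℓ :=
    mul_nonneg (hm i j) (Real.rpow_nonneg (norm_nonneg _) _)
  calc _ = ∑ p ∈ (atomicMeasure a x).support ×ˢ (atomicMeasure b y).support,
        if (x i, y j) = p then m i j * ‖x i - y j‖ ^ ℓ else 0 := by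
        refine Finset.sum_congr rfl fun p _ => ?_
        rw [ite_mul, zero_mul]
        by_cases h : (x i, y j) = p
        · subst h; simp
        · rw [if_neg h, if_neg fun h' => h (Prod.ext h'.1 h'.2)]
    _ ≤ _ := by
        rw [Finset.sum_ite_eq]
        split_ifs
        exacts [le_rfl, hnn]

/-- Transport as much mass as possible from `xᵢ` to `yᵢ`, and the remaining mass arbitrarily. -/
lemma Wpow_one_atomicMeasure_le {Θ : Set (Euc q)} {a b : ι → ℝ} {x y : ι → Euc q} {D : ℝ}
    (ha : a ∈ stdSimplex ℝ ι) (hb : b ∈ stdSimplex ℝ ι) (hx : ∀ i, x i ∈ Θ) (hy : ∀ i, y i ∈ Θ)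
    (hD : ∀ u ∈ Θ, ∀ v ∈ Θ, ‖u - v‖ ≤ D) :
    Wpow 1 (atomicMeasure a x) (atomicMeasure b y) ≤
      ∑ i, ‖x i - y i‖ + (1 - ∑ i, min (a i) (b i)) * D := by
  classical
  set c : ι → ℝ := fun i => min (a i) (b i) with hc
  set R : ℝ := 1 - ∑ i, c i with hR
  have hca : ∀ i, 0 ≤ a i - c i := fun i => sub_nonneg.2 (min_le_left _ _)
  have hcb : ∀ i, 0 ≤ b i - c i := fun i => sub_nonneg.2 (min_le_right _ _)
  have hc0 : ∀ i, 0 ≤ c i := fun i => le_min (ha.1 i) (hb.1 i)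
  have hc1 : ∀ i, c i ≤ 1 := fun i => (min_le_left _ _).trans
    (ha.2 ▸ Finset.single_le_sum (fun j _ => ha.1 j) (Finset.mem_univ i))
  have sa : ∑ i, (a i - c i) = R := by rw [Finset.sum_sub_distrib, ha.2]
  have sb : ∑ i, (b i - c i) = R := by rw [Finset.sum_sub_distrib, hb.2]
  have hR0 : 0 ≤ R := sa ▸ Finset.sum_nonneg fun i _ => hca i
  have cancel : ∀ d : ι → ℝ, (∀ i, 0 ≤ d i) → ∑ i, d i = R → ∀ i, d i * R / R = d i := by
    intro d hd hs i
    by_cases h : R = 0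
    · rw [h, Finset.sum_eq_zero_iff_of_nonneg fun i _ => hd i] at hs
      simp [hs i (Finset.mem_univ i)]
    · field_simp
  set r : ι → ι → ℝ := fun i j => (a i - c i) * (b j - c j) / R with hr
  have hr0 : ∀ i j, 0 ≤ r i j := fun i j => div_nonneg (mul_nonneg (hca i) (hcb j)) hR0
  have rrow : ∀ i, ∑ j, r i j = a i - c i := fun i => by
    simp only [hr]
    rw [← Finset.sum_div, ← Finset.mul_sum, sb, cancel _ hca sa]
  have rcol : ∀ j, ∑ i, r i j = b j - c j := fun j => by
    simp only [hr]
    rw [← Finset.sum_div, ← Finset.sum_mul, sa, mul_comm, cancel _ hcb sb]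
  refine (Wpow_atomicMeasure_le (m := fun i j => (if i = j then c i else 0) + r i j)
    (fun i j => add_nonneg ?_ (hr0 i j)) (fun i => ?_) fun j => ?_).trans ?_
  · split_ifs
    exacts [hc0 i, le_rfl]
  · rw [Finset.sum_add_distrib, rrow]
    simp
  · rw [Finset.sum_add_distrib, rcol]
    simp
  · simp only [Real.rpow_one, add_mul, Finset.sum_add_distrib, ite_mul, zero_mul,
      Finset.sum_ite_eq, Finset.mem_univ, if_true]
    refine add_le_add (Finset.sum_le_sum fun i _ => ?_) ?_
    · exact mul_le_of_le_one_left (norm_nonneg _) (hc1 i)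
    · calc _ ≤ ∑ i, ∑ j, r i j * D := by
            refine Finset.sum_le_sum fun i _ => Finset.sum_le_sum fun j _ => ?_
            exact mul_le_mul_of_nonneg_left (hD _ (hx i) _ (hy j)) (hr0 i j)
        _ = R * D := by simp only [← Finset.sum_mul, rrow, sa]

end Atomic

/-- Mixing measures near `G0` are uniformly separated from those at a definite distance. -/
lemma exists_le_phiDist_of_far {q k : ℕ} {Θ : Set (Euc q)} (hΘ : IsCompact Θ)
    {Φ : Set (Euc q → ℝ)} (hcont : ∀ φ ∈ Φ, ContinuousOn φ Θ)
    {G0 : Euc q →₀ ℝ} (hG0 : MixG Θ k G0)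
    (hdist : ∀ G H : Euc q →₀ ℝ, MixG Θ k G → MixG Θ k H → G ≠ H → 0 < phiDist Φ G H)
    {r0 : ℝ} (hr0 : 0 < r0) :
    ∃ r > (0 : ℝ), ∃ c > (0 : ℝ), ∀ G H : Euc q →₀ ℝ, MixG Θ k G → MixG Θ k H →
      Wpow 1 G G0 < r → r0 < Wpow 1 H G0 → ENNReal.ofReal c ≤ phiDist Φ G H := by
  set K : Set ((Fin k → ℝ) × (Fin k → Euc q)) :=
    stdSimplex ℝ (Fin k) ×ˢ Set.univ.pi fun _ => Θ with hK
  have hKc : IsCompact K := (isCompact_stdSimplex ℝ (Fin k)).prod (isCompact_univ_pi fun _ => hΘ)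
  suffices h : ∃ r > (0 : ℝ), ∃ c > (0 : ℝ), ∀ z ∈ K, ∀ G : Euc q →₀ ℝ, MixG Θ k G →
      Wpow 1 G G0 < r → r0 < Wpow 1 (atomicMeasure z.1 z.2) G0 →
      ENNReal.ofReal c ≤ phiDist Φ G (atomicMeasure z.1 z.2) by
    obtain ⟨r, hr, c, hc, h⟩ := h
    refine ⟨r, hr, c, hc, fun G H hG hH hGr hHr => ?_⟩
    obtain ⟨a, ha, x, hx, rfl⟩ := exists_eq_atomicMeasure hH
    exact h (a, x) ⟨ha, fun i _ => hx i⟩ G hG hGr hHr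
  refine hKc.induction_on (p := fun s => ∃ r > (0 : ℝ), ∃ c > (0 : ℝ), ∀ z ∈ s,
    ∀ G : Euc q →₀ ℝ, MixG Θ k G → Wpow 1 G G0 < r → r0 < Wpow 1 (atomicMeasure z.1 z.2) G0 →
      ENNReal.ofReal c ≤ phiDist Φ G (atomicMeasure z.1 z.2)) ?_ ?_ ?_ ?_
  · exact ⟨1, one_pos, 1, one_pos, fun z hz => hz.elim⟩
  · rintro s t hst ⟨r, hr, c, hc, h⟩
    exact ⟨r, hr, c, hc, fun z hz => h z (hst hz)⟩
  · rintro s t ⟨r, hr, c, hc, h⟩ ⟨r', hr', c', hc', h'⟩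
    refine ⟨min r r', lt_min hr hr', min c c', lt_min hc hc', ?_⟩
    rintro z (hz | hz) G hG hGr hz0
    · exact (ENNReal.ofReal_le_ofReal (min_le_left _ _)).trans
        (h z hz G hG (hGr.trans_le (min_le_left _ _)) hz0)
    · exact (ENNReal.ofReal_le_ofReal (min_le_right _ _)).trans
        (h' z hz G hG (hGr.trans_le (min_le_right _ _)) hz0)
  · intro z hz
    by_cases hzG : atomicMeasure z.1 z.2 = G0
    · obtain ⟨D, hD⟩ : ∃ D, ∀ u ∈ Θ, ∀ v ∈ Θ, ‖u - v‖ ≤ D :=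
        ⟨Metric.diam Θ, fun u hu v hv => by
          rw [← dist_eq_norm]
          exact Metric.dist_le_diam_of_mem hΘ.isBounded hu hv⟩
      have hF : Continuous fun w : (Fin k → ℝ) × (Fin k → Euc q) =>
          ∑ i, ‖w.2 i - z.2 i‖ + (1 - ∑ i, min (w.1 i) (z.1 i)) * D := by fun_prop
      have hF0 : ∑ i, ‖z.2 i - z.2 i‖ + (1 - ∑ i, min (z.1 i) (z.1 i)) * D < r0 := by
        simpa [hz.1.2] using hr0
      refine ⟨{w | ∑ i, ‖w.2 i - z.2 i‖ + (1 - ∑ i, min (w.1 i) (z.1 i)) * D < r0} ∩ K,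
        Filter.inter_mem (mem_nhdsWithin_of_mem_nhds
          (hF.continuousAt.eventually_lt continuousAt_const hF0)) self_mem_nhdsWithin,
        1, one_pos, 1, one_pos, ?_⟩
      rintro w ⟨hw, hwK⟩ G - - hw0
      have := Wpow_one_atomicMeasure_le hwK.1 hz.1 (fun i => hwK.2 i (Set.mem_univ i))
        (fun i => hz.2 i (Set.mem_univ i)) hD
      rw [hzG] at this
      exact absurd (hw0.trans_le this) (not_lt.2 (le_of_lt hw))
    · have hmix : MixG Θ k (atomicMeasure z.1 z.2) :=
        ⟨isMixingMeasure_atomicMeasure hz.1 fun i => hz.2 i (Set.mem_univ i),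
          by simpa using card_support_atomicMeasure_le z.1 z.2⟩
      have hpos := hdist _ _ hmix hG0 hzG
      simp only [phiDist, lt_iSup_iff] at hpos
      obtain ⟨φ, hφ, hpos⟩ := hpos
      rw [ENNReal.ofReal_pos] at hpos
      set ε := |mixInt (atomicMeasure z.1 z.2) φ - mixInt G0 φ| / 4 with hε
      have hε0 : 0 < ε := by positivity
      obtain ⟨M, hM, hφM⟩ := exists_abs_sub_le_add_mul_norm hΘ (hcont φ hφ) hε0
      have hF : ContinuousOn (fun w : (Fin k → ℝ) × (Fin k → Euc q) =>
          |mixInt (atomicMeasure w.1 w.2) φ - mixInt G0 φ|) K := by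
        simp only [mixInt_atomicMeasure]
        refine ContinuousOn.abs (ContinuousOn.sub (continuousOn_finsetSum _ fun i _ =>
          ContinuousOn.mul (by fun_prop) ?_) continuousOn_const)
        exact (hcont φ hφ).comp (by fun_prop) fun w hw => hw.2 i (Set.mem_univ i)
      have hev := (hF z hz).eventually_const_lt
        (show 3 * ε < |mixInt (atomicMeasure z.1 z.2) φ - mixInt G0 φ| by linarith)
      refine ⟨_, hev, ε / M, by positivity, ε, hε0, ?_⟩
      intro w hw G hG hGr _
      have hw : 3 * ε < |mixInt (atomicMeasure w.1 w.2) φ - mixInt G0 φ| := hw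
      have h1 := abs_mixInt_sub_le hG.1 hG0.1 hM hφM
      rw [lt_div_iff₀ hM] at hGr
      have h2 := abs_sub_le (mixInt (atomicMeasure w.1 w.2) φ) (mixInt G φ) (mixInt G0 φ)
      rw [abs_sub_comm _ (mixInt G φ)] at h2
      refine le_trans (ENNReal.ofReal_le_ofReal ?_)
        (le_iSup₂ (f := fun φ (_ : φ ∈ Φ) => ENNReal.ofReal
          |mixInt G φ - mixInt (atomicMeasure w.1 w.2) φ|) φ hφ)
      linarith

lemma phiDist_le_add {q : ℕ} (Φ : Set (Euc q → ℝ)) (G H : Euc q →₀ ℝ) (T : (Euc q → ℝ) → ℝ) :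
    phiDist Φ G H ≤ phiDistT Φ G T + phiDistT Φ H T := by
  refine iSup₂_le fun φ hφ => ?_
  refine le_trans ?_ (add_le_add
    (le_iSup₂ (f := fun φ (_ : φ ∈ Φ) => ENNReal.ofReal |mixInt G φ - T φ|) φ hφ)
    (le_iSup₂ (f := fun φ (_ : φ ∈ Φ) => ENNReal.ofReal |mixInt H φ - T φ|) φ hφ))
  rw [← ENNReal.ofReal_add (abs_nonneg _) (abs_nonneg _)]
  refine ENNReal.ofReal_le_ofReal ?_
  rw [abs_sub_comm (mixInt H φ)]
  exact abs_sub_le _ _ _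

/-- local uniform bound for minimum Φ-distance estimators. -/
theorem min_phi_distance_estimator_local_bound {q k k0 : ℕ} (hk0 : 1 ≤ k0) (hk0k : k0 ≤ k)
    (Θ : Set (Euc q)) (hΘ : IsCompact Θ)
    (Φ : Set (Euc q → ℝ)) (hcont : ∀ φ ∈ Φ, ContinuousOn φ Θ)
    (G0 : Euc q →₀ ℝ) (hG0 : MixE Θ k0 G0)
    (hdist : ∀ G H : Euc q →₀ ℝ, MixG Θ k G → MixG Θ k H → G ≠ H → 0 < phiDist Φ G H)
    (hloc : ∃ r0 > (0:ℝ), ∃ c0 > (0:ℝ), ∀ G H : Euc q →₀ ℝ,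
      MixG Θ k G → MixG Θ k H → G ≠ H →
      Wpow 1 G G0 ≤ r0 → Wpow 1 H G0 ≤ r0 →
      ENNReal.ofReal (c0 * Wpow ((2 * (k - k0 + 1) - 1 : ℕ) : ℝ) G H) ≤ phiDist Φ G H) :
    ∃ r > (0:ℝ), ∃ C > (0:ℝ),
      ∀ Gstar : Euc q →₀ ℝ, MixG Θ k Gstar → Wpow 1 G0 Gstar < r →
      ∀ T : (Euc q → ℝ) → ℝ,
      ∀ Ghat : Euc q →₀ ℝ, MixG Θ k Ghat →
        (∀ G' : Euc q →₀ ℝ, MixG Θ k G' → phiDistT Φ Ghat T ≤ phiDistT Φ G' T) →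
      ∀ t : ℝ, 0 < t → t ≤ Wpow ((2 * (k - k0 + 1) - 1 : ℕ) : ℝ) Gstar Ghat →
      ENNReal.ofReal (C * min t 1) ≤ phiDistT Φ Gstar T := by
  obtain ⟨r0, hr0, c0, hc0, hloc⟩ := hloc
  obtain ⟨r, hr, c, hc, hfar⟩ :=
    exists_le_phiDist_of_far hΘ hcont ⟨hG0.1, hG0.2.trans_le hk0k⟩ hdist hr0
  have hmin : 0 < min c0 c := lt_min hc0 hc
  refine ⟨min r r0, lt_min hr hr0, min c0 c / 2, half_pos hmin, ?_⟩
  intro Gs hGs hGsr T Gh hGh hopt t ht htW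
  rw [Wpow_comm] at hGsr
  have hne : Gs ≠ Gh := by
    rintro rfl
    have hℓ : ((2 * (k - k0 + 1) - 1 : ℕ) : ℝ) ≠ 0 := Nat.cast_ne_zero.2 (by omega)
    exact absurd (ht.trans_le htW) (not_lt.2 (Wpow_self hℓ hGs.1.1))
  have hmt : 0 < min t 1 := lt_min ht one_pos
  have hsep : ENNReal.ofReal (min c0 c * min t 1) ≤ phiDist Φ Gs Gh := by
    rcases le_or_gt (Wpow 1 Gh G0) r0 with h | h
    · refine le_trans (ENNReal.ofReal_le_ofReal ?_)
        (hloc Gs Gh hGs hGh hne (hGsr.le.trans (min_le_right _ _)) h)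
      exact mul_le_mul (min_le_left _ _) ((min_le_left _ _).trans htW) hmt.le hc0.le
    · refine le_trans (ENNReal.ofReal_le_ofReal ?_)
        (hfar Gs Gh hGs hGh (hGsr.trans_le (min_le_left _ _)) h)
      calc min c0 c * min t 1 ≤ c * 1 :=
            mul_le_mul (min_le_right _ _) (min_le_right _ _) hmt.le hc.le
        _ = c := mul_one c
  have htri : phiDist Φ Gs Gh ≤ 2 * phiDistT Φ Gs T := by
    rw [two_mul]
    exact (phiDist_le_add Φ Gs Gh T).trans (by gcongr; exact hopt Gs hGs)
  have h2 : ENNReal.ofReal (min c0 c * min t 1)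
      = 2 * ENNReal.ofReal (min c0 c / 2 * min t 1) := by
    rw [show min c0 c * min t 1 = 2 * (min c0 c / 2 * min t 1) by ring,
      ENNReal.ofReal_mul zero_le_two, ENNReal.ofReal_ofNat]
  rw [h2] at hsep
  exact (ENNReal.mul_le_mul_iff_right two_ne_zero ENNReal.ofNat_ne_top).1 (hsep.trans htri)

end
end

section
/- Let Θ ⊆ ℝ^q be compact, let 1 ≤ k0 ≤ k and d1 = k − k0 + 1. If Φ is a (2d1−1, k0, k) linear independent domain, then for every G0 ∈ E_{k0}(Θ) the local inverse bound holds at G0: there exist r > 0 and c > 0 such that sup_{φ∈Φ}|Gφ − Hφ| ≥ c · W_{2d1−1}(G,H)^{2d1−1} for all G ≠ H ∈ G_k(Θ) with W_1(G,G0) ≤ r and W_1(H,G0) ≤ r. -/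
open scoped BigOperators ENNReal

noncomputable section

/-- `Φ` is an `(m, k0, k)` linear independent domain on `Θ`. -/
def LinIndepDomain {q : ℕ} (Θ : Set (Euc q)) (Φ : Set (Euc q → ℝ)) (m k0 k : ℕ) : Prop :=
  (∀ φ ∈ Φ, ∃ U : Set (Euc q), IsOpen U ∧ Θ ⊆ U ∧ ContDiffOn ℝ m φ U) ∧
  ∀ ℓ : ℕ, k0 ≤ ℓ → ℓ ≤ 2 * k - k0 →
    ∀ mv : Fin ℓ → ℕ, (∀ i, 1 ≤ mv i) → (∀ i, mv i ≤ m + 1) →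
      2 * k0 ≤ ∑ i, mv i → (∑ i, mv i) ≤ 2 * k →
    ∀ θ : Fin ℓ → Euc q, Function.Injective θ → (∀ i, θ i ∈ Θ) →
    ∀ a : Fin ℓ → (Fin q → ℕ) → ℝ,
      (∀ φ ∈ Φ, ∑ i, ∑ α ∈ multiIdx q (mv i - 1), a i α * Dmulti α φ (θ i) = 0) →
      (∑ i, a i 0 = 0) →
      ∀ i, ∀ α ∈ multiIdx q (mv i - 1), a i α = 0


section Derivatives

variable {q : ℕ}

lemma mem_multiIdx {n : ℕ} {α : Fin q → ℕ} : α ∈ multiIdx q n ↔ ∑ j, α j ≤ n := by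
  simp only [multiIdx, Finset.mem_filter, Fintype.mem_piFinset, Finset.mem_range,
    and_iff_right_iff_imp]
  intro h j
  have := Finset.single_le_sum (f := α) (fun _ _ => Nat.zero_le _) (Finset.mem_univ j)
  omega

lemma pderivSeq_eqOn {U : Set (Euc q)} (hU : IsOpen U) (l : List (Fin q)) :
    ∀ {f g : Euc q → ℝ}, Set.EqOn f g U → Set.EqOn (pderivSeq l f) (pderivSeq l g) U := by
  induction l with
  | nil => intro f g h; exact h
  | cons i l ih =>
    intro f g h
    refine ih fun x hx => ?_
    have : f =ᶠ[nhds x] g := h.eventuallyEq_of_mem (hU.mem_nhds hx)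
    simp only [this.fderiv_eq]

lemma contDiffOn_pderiv {U : Set (Euc q)} (hU : IsOpen U) {n : ℕ} {f : Euc q → ℝ}
    (hf : ContDiffOn ℝ (n + 1 : ℕ) f U) (i : Fin q) :
    ContDiffOn ℝ n (fun x => fderiv ℝ f x (EuclideanSpace.single i 1)) U :=
  (hf.fderiv_of_isOpen hU (m := n) (by norm_cast)).clm_apply contDiffOn_const

lemma contDiffOn_pderivSeq {U : Set (Euc q)} (hU : IsOpen U) (r : ℕ) (l : List (Fin q)) :
    ∀ {f : Euc q → ℝ}, ContDiffOn ℝ (l.length + r : ℕ) f U →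
      ContDiffOn ℝ r (pderivSeq l f) U := by
  induction l with
  | nil => intro f h; simpa [pderivSeq] using h
  | cons i l ih =>
    intro f h
    refine ih (contDiffOn_pderiv hU (n := l.length + r) ?_ i)
    convert h using 2
    simp only [List.length_cons]; ring

lemma pderivSeq_sub {U : Set (Euc q)} (hU : IsOpen U) (l : List (Fin q)) :
    ∀ {f g : Euc q → ℝ}, ContDiffOn ℝ l.length f U → ContDiffOn ℝ l.length g U →
      Set.EqOn (pderivSeq l (fun x => f x - g x)) (fun x => pderivSeq l f x - pderivSeq l g x) U := by
  induction l with
  | nil => intro f g _ _ x _; rfl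
  | cons i l ih =>
    intro f g hf hg x hx
    have h := ih (contDiffOn_pderiv hU hf i) (contDiffOn_pderiv hU hg i) hx
    refine Eq.trans (pderivSeq_eqOn hU l ?_ hx) h
    intro y hy
    have h1 := (hf.differentiableOn (by simp)).differentiableAt (hU.mem_nhds hy)
    have h2 := (hg.differentiableOn (by simp)).differentiableAt (hU.mem_nhds hy)
    simp only [fderiv_fun_sub h1 h2, sub_apply]

lemma pderiv_comm {U : Set (Euc q)} (hU : IsOpen U) {f : Euc q → ℝ}
    (hf : ContDiffOn ℝ 2 f U) {x : Euc q} (hx : x ∈ U) (u v : Euc q) :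
    fderiv ℝ (fun y => fderiv ℝ f y u) x v = fderiv ℝ (fun y => fderiv ℝ f y v) x u := by
  have hfx : ContDiffAt ℝ 2 f x := hf.contDiffAt (hU.mem_nhds hx)
  have hd : DifferentiableAt ℝ (fderiv ℝ f) x :=
    (hfx.fderiv_right (m := 1) (by norm_num)).differentiableAt (by norm_num)
  have hs : IsSymmSndFDerivAt ℝ f x := hfx.isSymmSndFDerivAt (by simp)
  have key : ∀ a b : Euc q, fderiv ℝ (fun y => fderiv ℝ f y a) x b
      = fderiv ℝ (fderiv ℝ f) x b a := by
    intro a b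
    rw [fderiv_clm_apply hd (differentiableAt_const a)]
    simp
  rw [key, key]
  exact hs v u

lemma pderivSeq_perm {U : Set (Euc q)} (hU : IsOpen U) {l l' : List (Fin q)} (h : l.Perm l') :
    ∀ {f : Euc q → ℝ}, ContDiffOn ℝ l.length f U →
      Set.EqOn (pderivSeq l f) (pderivSeq l' f) U := by
  induction h with
  | nil => intro f _ x _; rfl
  | cons i _ ih => intro f hf; exact ih (contDiffOn_pderiv hU hf i)
  | swap i j l =>
    intro f hf
    refine pderivSeq_eqOn hU l fun x hx => ?_
    refine pderiv_comm hU (hf.of_le ?_) hx _ _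
    simp only [List.length_cons]
    norm_cast
    omega
  | trans h1 _ ih1 ih2 =>
    intro f hf
    exact (ih1 hf).trans (ih2 (h1.length_eq ▸ hf))

lemma pderivSeq_eq_Dmulti {U : Set (Euc q)} (hU : IsOpen U) {l : List (Fin q)}
    {f : Euc q → ℝ} (hf : ContDiffOn ℝ l.length f U) {x : Euc q} (hx : x ∈ U) :
    pderivSeq l f x = Dmulti (fun i => l.count i) f x := by
  refine pderivSeq_perm hU ?_ hf hx
  rw [List.perm_iff_count]
  intro a
  rw [List.count_flatMap]
  simp only [Function.comp_def, List.count_replicate]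
  rw [← List.ofFn_eq_map, List.sum_ofFn]
  simp

/-- The monomial `(x - θ)^α`. -/
def shiftedMonomial (θ : Euc q) (α : Fin q → ℕ) (x : Euc q) : ℝ := ∏ i, (x i - θ i) ^ α i

lemma shiftedMonomial_zero (θ x : Euc q) : shiftedMonomial θ 0 x = 1 := by
  simp [shiftedMonomial]

lemma shiftedMonomial_add_single (θ : Euc q) (α : Fin q → ℕ) (i : Fin q) (x : Euc q) :
    shiftedMonomial θ (α + Pi.single i 1) x = (x i - θ i) * shiftedMonomial θ α x := by
  simp only [shiftedMonomial, Pi.add_apply, pow_add, Finset.prod_mul_distrib]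
  rw [mul_comm]
  congr 1
  rw [Finset.prod_eq_single i]
  · simp
  · intro j _ hj; simp [Pi.single_eq_of_ne hj]
  · simp

lemma contDiff_shiftedMonomial (θ : Euc q) (α : Fin q → ℕ) {n : WithTop ℕ∞} :
    ContDiff ℝ n (shiftedMonomial θ α) := by
  unfold shiftedMonomial
  fun_prop

lemma fderiv_shiftedMonomial (θ : Euc q) (α : Fin q → ℕ) (i : Fin q) (x : Euc q) :
    fderiv ℝ (shiftedMonomial θ α) x (EuclideanSpace.single i 1) =
      α i * shiftedMonomial θ (α - Pi.single i 1) x := by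
  have hcoord : ∀ j : Fin q, HasFDerivAt (fun y : Euc q => y j - θ j)
      (EuclideanSpace.proj j : Euc q →L[ℝ] ℝ) x := fun j =>
    ((EuclideanSpace.proj j : Euc q →L[ℝ] ℝ).hasFDerivAt).sub_const _
  have h := HasFDerivAt.finsetProd (u := Finset.univ)
    (fun j _ => (hcoord j).pow (α j))
  unfold shiftedMonomial
  rw [h.fderiv]
  simp only [sum_apply, smul_apply, smul_eq_mul]
  rw [Finset.sum_eq_single i]
  · rw [← Finset.mul_prod_erase Finset.univ _ (Finset.mem_univ i)]
    have : ∏ j ∈ Finset.univ.erase i, (x j - θ j) ^ (α - Pi.single i 1 : Fin q → ℕ) j =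
        ∏ j ∈ Finset.univ.erase i, (x j - θ j) ^ α j := by
      refine Finset.prod_congr rfl fun j hj => ?_
      simp [Pi.single_eq_of_ne (Finset.ne_of_mem_erase hj)]
    rw [this]
    simp
    ring
  · intro j _ hj
    simp [hj]
  · simp

lemma pderivSeq_sum_shiftedMonomial {ι : Type*} (θ : Euc q) (s : Finset ι) (l : List (Fin q)) :
    ∀ (c : ι → ℝ) (e : ι → Fin q → ℕ),
      pderivSeq l (fun x => ∑ j ∈ s, c j * shiftedMonomial θ (e j) x) θ =
        ∑ j ∈ s, c j * if e j = (fun i => l.count i) then ∏ i, ((e j i).factorial : ℝ) else 0 := by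
  induction l with
  | nil =>
    intro c e
    refine Finset.sum_congr rfl fun j _ => ?_
    congr 1
    split_ifs with h
    · rw [h]; simp [shiftedMonomial]
    · obtain ⟨i, hi⟩ : ∃ i, e j i ≠ 0 := by
        by_contra! hc
        exact h (funext fun i => by simp [hc i])
      exact Finset.prod_eq_zero (Finset.mem_univ i) (by simp [hi])
  | cons a l ih =>
    intro c e
    have hfun : (fun x => fderiv ℝ (fun x => ∑ j ∈ s, c j * shiftedMonomial θ (e j) x) x
        (EuclideanSpace.single a 1)) = fun x => ∑ j ∈ s, (c j * e j a) *
          shiftedMonomial θ (e j - Pi.single a 1) x := by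
      funext x
      have hd : ∀ j, DifferentiableAt ℝ (shiftedMonomial θ (e j)) x := fun j =>
        (contDiff_shiftedMonomial θ (e j) (n := 1)).differentiable (by norm_num) x
      rw [fderiv_fun_sum fun j _ => (hd j).const_mul (c j)]
      simp only [sum_apply]
      refine Finset.sum_congr rfl fun j _ => ?_
      rw [fderiv_const_mul (hd j)]
      simp only [smul_apply, smul_eq_mul, fderiv_shiftedMonomial]
      ring
    change pderivSeq l _ θ = _
    rw [hfun, ih]
    refine Finset.sum_congr rfl fun j _ => ?_
    rw [mul_assoc]
    congr 1
    by_cases h0 : e j a = 0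
    · have h : e j ≠ fun i => (a :: l).count i := by
        intro h
        have := congrFun h a
        simp [h0] at this
      simp [h0, h]
    · have hiff : (e j - Pi.single a 1 = fun i => l.count i) ↔
          (e j = fun i => (a :: l).count i) := by
        simp only [funext_iff, Pi.sub_apply, List.count_cons]
        refine forall_congr' fun i => ?_
        by_cases hi : i = a
        · subst hi; simp; omega
        · have hi' : ¬ a = i := fun h => hi h.symm
          simp [hi, hi']
      simp only [hiff]
      split_ifs
      · rw [← Finset.mul_prod_erase Finset.univ _ (Finset.mem_univ a),
          ← Finset.mul_prod_erase Finset.univ (fun i => ((e j i).factorial : ℝ))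
            (Finset.mem_univ a), ← mul_assoc]
        congr 1
        · simp only [Pi.sub_apply, Pi.single_eq_same]
          norm_cast
          exact Nat.mul_factorial_pred h0
        · refine Finset.prod_congr rfl fun i hi => ?_
          simp [Pi.single_eq_of_ne (Finset.ne_of_mem_erase hi)]
      · simp

end Derivatives

section MomentBounds

variable {q : ℕ}

lemma sum_coord_sub_mul_shiftedMonomial (θ y : Euc q) (S : Finset (Euc q)) (w : Euc q → ℝ)
    (i : Fin q) (α : Fin q → ℕ) :
    ∑ x ∈ S, w x * (x i - y i) * shiftedMonomial θ α x =
      ∑ x ∈ S, w x * shiftedMonomial θ (α + Pi.single i 1) x -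
        (y i - θ i) * ∑ x ∈ S, w x * shiftedMonomial θ α x := by
  rw [Finset.mul_sum, ← Finset.sum_sub_distrib]
  refine Finset.sum_congr rfl fun x _ => ?_
  rw [shiftedMonomial_add_single]
  ring

lemma sum_add_single (α : Fin q → ℕ) (i : Fin q) :
    ∑ j, (α + Pi.single i 1 : Fin q → ℕ) j = ∑ j, α j + 1 := by
  simp [Finset.sum_add_distrib]

/-- The affine function equal to `1` at `a` and to `0` at `b`. -/
def affineSeparator (a b x : Euc q) : ℝ := (∑ i, (x i - b i) * (a i - b i)) / ‖a - b‖ ^ 2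

lemma norm_sub_sq_eq_sum (a b : Euc q) : ‖a - b‖ ^ 2 = ∑ i, (a i - b i) * (a i - b i) := by
  rw [EuclideanSpace.norm_sq_eq]
  refine Finset.sum_congr rfl fun i _ => ?_
  simp [sq]

lemma affineSeparator_right (a b : Euc q) : affineSeparator a b b = 0 := by
  simp [affineSeparator]

lemma affineSeparator_add_swap {a b : Euc q} (hab : a ≠ b) (x : Euc q) :
    affineSeparator a b x + affineSeparator b a x = 1 := by
  have hn : ‖a - b‖ ^ 2 ≠ 0 := by
    have := norm_pos_iff.2 (sub_ne_zero.2 hab); positivity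
  unfold affineSeparator
  rw [norm_sub_rev b a, ← add_div, div_eq_one_iff_eq hn, norm_sub_sq_eq_sum,
    ← Finset.sum_add_distrib]
  exact Finset.sum_congr rfl fun i _ => by ring

lemma abs_coord_sub_div_le {a b : Euc q} {ε : ℝ} (hε : 0 < ε) (hab : ε ≤ ‖a - b‖) (i : Fin q) :
    |(a i - b i) / ‖a - b‖ ^ 2| ≤ 1 / ε := by
  have hp : 0 < ‖a - b‖ := hε.trans_le hab
  rw [abs_div, abs_of_pos (pow_pos hp 2)]
  have h1 : |a i - b i| ≤ ‖a - b‖ := by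
    simpa using PiLp.norm_apply_le (a - b) i
  calc |a i - b i| / ‖a - b‖ ^ 2 ≤ ‖a - b‖ / ‖a - b‖ ^ 2 := by gcongr
    _ = 1 / ‖a - b‖ := by field_simp
    _ ≤ 1 / ε := by gcongr

lemma abs_moment_affineSeparator_le (θ : Euc q) {n : ℕ} {ε M : ℝ} (hε : 0 < ε)
    {A B : Finset (Euc q)} {a b : Euc q} (hab : ε ≤ ‖a - b‖) (hb : ∀ i, |b i - θ i| ≤ 1)
    {w : Euc q → ℝ}
    (hw : ∀ α : Fin q → ℕ, ∑ i, α i ≤ n + 1 →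
      |∑ x ∈ A, w x * shiftedMonomial θ α x + ∑ x ∈ B, w x * shiftedMonomial θ α x| ≤ M)
    (α : Fin q → ℕ) (hα : ∑ i, α i ≤ n) :
    |∑ x ∈ A, w x * affineSeparator a b x * shiftedMonomial θ α x +
      ∑ x ∈ B, w x * affineSeparator a b x * shiftedMonomial θ α x| ≤ 2 * q * M / ε := by
  have hM : 0 ≤ M := (abs_nonneg _).trans (hw α (by omega))
  have expand : ∀ S : Finset (Euc q),
      ∑ x ∈ S, w x * affineSeparator a b x * shiftedMonomial θ α x =
        ∑ i, (a i - b i) / ‖a - b‖ ^ 2 *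
          (∑ x ∈ S, w x * shiftedMonomial θ (α + Pi.single i 1) x -
            (b i - θ i) * ∑ x ∈ S, w x * shiftedMonomial θ α x) := by
    intro S
    simp_rw [← sum_coord_sub_mul_shiftedMonomial, Finset.mul_sum]
    rw [Finset.sum_comm]
    refine Finset.sum_congr rfl fun x _ => ?_
    unfold affineSeparator
    rw [Finset.sum_div, Finset.mul_sum, Finset.sum_mul]
    exact Finset.sum_congr rfl fun i _ => by ring
  rw [expand, expand, ← Finset.sum_add_distrib]
  refine (Finset.abs_sum_le_sum_abs _ _).trans ?_
  have hterm : ∀ i ∈ (Finset.univ : Finset (Fin q)),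
      |(a i - b i) / ‖a - b‖ ^ 2 *
          (∑ x ∈ A, w x * shiftedMonomial θ (α + Pi.single i 1) x -
            (b i - θ i) * ∑ x ∈ A, w x * shiftedMonomial θ α x) +
        (a i - b i) / ‖a - b‖ ^ 2 *
          (∑ x ∈ B, w x * shiftedMonomial θ (α + Pi.single i 1) x -
            (b i - θ i) * ∑ x ∈ B, w x * shiftedMonomial θ α x)| ≤ 1 / ε * (2 * M) := by
    intro i _
    have h1 := hw (α + Pi.single i 1) (by rw [sum_add_single]; omega)
    have h2 := hw α (by omega)
    have h3 := abs_coord_sub_div_le hε hab i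
    set P := (a i - b i) / ‖a - b‖ ^ 2
    set X := ∑ x ∈ A, w x * shiftedMonomial θ (α + Pi.single i 1) x
    set X' := ∑ x ∈ B, w x * shiftedMonomial θ (α + Pi.single i 1) x
    set Y := ∑ x ∈ A, w x * shiftedMonomial θ α x
    set Y' := ∑ x ∈ B, w x * shiftedMonomial θ α x
    have : P * (X - (b i - θ i) * Y) + P * (X' - (b i - θ i) * Y') =
        P * ((X + X') - (b i - θ i) * (Y + Y')) := by ring
    rw [this, abs_mul]
    refine mul_le_mul h3 ?_ (abs_nonneg _) (by positivity)
    calc |(X + X') - (b i - θ i) * (Y + Y')| ≤ |X + X'| + |(b i - θ i) * (Y + Y')| := abs_sub _ _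
      _ = |X + X'| + |b i - θ i| * |Y + Y'| := by rw [abs_mul]
      _ ≤ M + 1 * M := by
        gcongr
        exact hb i
      _ = 2 * M := by ring
  refine (Finset.sum_le_sum hterm).trans (le_of_eq ?_)
  simp
  ring

/-- A signed weight on `A ∪ B` has controlled mass on `A` once `A` and `B` are separated and
the moments of the weight are small. -/
lemma abs_sum_mul_pow_le_of_separated (θ : Euc q) {ε : ℝ} (hε : 0 < ε) (hε1 : ε ≤ 1) (n : ℕ) :
    ∀ (A B : Finset (Euc q)), A.card + B.card ≤ n + 1 →
      (∀ a ∈ A, ∀ i, |a i - θ i| ≤ 1) → (∀ b ∈ B, ∀ i, |b i - θ i| ≤ 1) →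
      (∀ a ∈ A, ∀ b ∈ B, ε ≤ ‖a - b‖) → ∀ (w : Euc q → ℝ) (M : ℝ),
      (∀ α : Fin q → ℕ, ∑ i, α i ≤ n →
        |∑ x ∈ A, w x * shiftedMonomial θ α x + ∑ x ∈ B, w x * shiftedMonomial θ α x| ≤ M) →
      |∑ x ∈ A, w x| * ε ^ n ≤ (4 * q + 1) ^ n * M := by
  have triv : ∀ (n : ℕ) (A B : Finset (Euc q)) (w : Euc q → ℝ) (M : ℝ),
      (∀ α : Fin q → ℕ, ∑ i, α i ≤ n →
        |∑ x ∈ A, w x * shiftedMonomial θ α x + ∑ x ∈ B, w x * shiftedMonomial θ α x| ≤ M) →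
      (A = ∅ ∨ B = ∅) → |∑ x ∈ A, w x| * ε ^ n ≤ (4 * q + 1) ^ n * M := by
    intro n A B w M hw h
    have h0 := hw 0 (by simp)
    have hM : 0 ≤ M := (abs_nonneg _).trans h0
    have h1 : (1 : ℝ) ≤ (4 * q + 1) ^ n := one_le_pow₀ (by linarith [Nat.cast_nonneg (α := ℝ) q])
    rcases h with rfl | rfl
    · simp only [Finset.sum_empty, abs_zero, zero_mul]; positivity
    · simp only [shiftedMonomial_zero, mul_one, Finset.sum_empty, add_zero] at h0
      calc |∑ x ∈ A, w x| * ε ^ n ≤ M * 1 := by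
            gcongr
            exact pow_le_one₀ hε.le hε1
        _ ≤ (4 * q + 1) ^ n * M := by nlinarith
  induction n with
  | zero =>
    intro A B hcard _ _ _ w M hw
    refine triv 0 A B w M hw ?_
    by_contra! h
    have h1 := Finset.card_pos.2 h.1
    have h2 := Finset.card_pos.2 h.2
    omega
  | succ n ih =>
    intro A B hcard hA hB hsep w M hw
    rcases A.eq_empty_or_nonempty with hAe | ⟨a, ha⟩
    · exact triv _ A B w M hw (Or.inl hAe)
    rcases B.eq_empty_or_nonempty with hBe | ⟨b, hb⟩
    · exact triv _ A B w M hw (Or.inr hBe)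
    have hab : ε ≤ ‖a - b‖ := hsep a ha b hb
    have hne : a ≠ b := by
      rintro rfl
      simp at hab
      linarith
    have hca := Finset.card_erase_of_mem ha
    have hcb := Finset.card_erase_of_mem hb
    have hpa := Finset.card_pos.2 ⟨a, ha⟩
    have hpb := Finset.card_pos.2 ⟨b, hb⟩
    have h1 := ih A (B.erase b) (by omega) hA (fun x hx => hB x (Finset.mem_of_mem_erase hx))
      (fun x hx y hy => hsep x hx y (Finset.mem_of_mem_erase hy))
      (fun x => w x * affineSeparator a b x) (2 * q * M / ε) (by
        intro α hα
        rw [Finset.sum_erase B (by simp [affineSeparator_right])]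
        exact abs_moment_affineSeparator_le θ hε hab (hB b hb) hw α hα)
    have h2 := ih (A.erase a) B (by omega) (fun x hx => hA x (Finset.mem_of_mem_erase hx)) hB
      (fun x hx y hy => hsep x (Finset.mem_of_mem_erase hx) y hy)
      (fun x => w x * affineSeparator b a x) (2 * q * M / ε) (by
        intro α hα
        rw [Finset.sum_erase A (by simp [affineSeparator_right])]
        exact abs_moment_affineSeparator_le θ hε (norm_sub_rev a b ▸ hab) (hA a ha) hw α hα)
    rw [Finset.sum_erase _ (by simp [affineSeparator_right])] at h2
    have hsplit : ∑ x ∈ A, w x =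
        ∑ x ∈ A, w x * affineSeparator a b x + ∑ x ∈ A, w x * affineSeparator b a x := by
      rw [← Finset.sum_add_distrib]
      refine Finset.sum_congr rfl fun x _ => ?_
      rw [← mul_add, affineSeparator_add_swap hne, mul_one]
    have hM : 0 ≤ M := (abs_nonneg _).trans (hw 0 (by simp))
    calc |∑ x ∈ A, w x| * ε ^ (n + 1)
        ≤ (|∑ x ∈ A, w x * affineSeparator a b x| + |∑ x ∈ A, w x * affineSeparator b a x|)
            * ε ^ (n + 1) := by
          rw [hsplit]
          gcongr
          exact abs_add_le _ _
      _ = ε * (|∑ x ∈ A, w x * affineSeparator a b x| * ε ^ n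
            + |∑ x ∈ A, w x * affineSeparator b a x| * ε ^ n) := by ring
      _ ≤ ε * ((4 * q + 1) ^ n * (2 * q * M / ε) + (4 * q + 1) ^ n * (2 * q * M / ε)) := by
          gcongr
      _ = (4 * q + 1) ^ n * (4 * q * M) := by field_simp; ring
      _ ≤ (4 * q + 1) ^ n * ((4 * q + 1) * M) := by gcongr; linarith
      _ = (4 * q + 1) ^ (n + 1) * M := by ring

/-- A signed weight with small moments is small against every function with bounded partial
derivatives. -/
lemma abs_sum_mul_le_of_pderivSeq_bounded (θ : Euc q) {D : Set (Euc q)} (hD : Convex ℝ D)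
    {K : ℝ} (hK0 : 0 ≤ K) (n : ℕ) :
    ∀ (f : Euc q → ℝ),
      (∀ l : List (Fin q), l.length < n → ∀ x ∈ D, DifferentiableAt ℝ (pderivSeq l f) x) →
      (∀ l : List (Fin q), l.length ≤ n → ∀ x ∈ D, |pderivSeq l f x| ≤ K) →
      ∀ (S : Finset (Euc q)), S.card ≤ n + 1 → (∀ x ∈ S, ∀ i, |x i - θ i| ≤ 1) →
      ∀ (w : Euc q → ℝ) (M : ℝ),
      (∀ α : Fin q → ℕ, ∑ i, α i ≤ n → |∑ x ∈ S, w x * shiftedMonomial θ α x| ≤ M) →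
      ∀ (s : ℝ) (v : Euc q), 0 ≤ s → s ≤ 1 → (∀ x ∈ S, s • x + v ∈ D) →
      |∑ x ∈ S, w x * f (s • x + v)| ≤ (2 * q + 1) ^ n * M * K := by
  induction n with
  | zero =>
    intro f _ hK S hS _ w M hw s v _ _ hsv
    have h0 := hw 0 (by simp)
    have hM : 0 ≤ M := (abs_nonneg _).trans h0
    simp only [shiftedMonomial_zero, mul_one] at h0
    simp only [pow_zero, one_mul]
    rcases S.eq_empty_or_nonempty with rfl | ⟨y, hy⟩
    · simp only [Finset.sum_empty, abs_zero]
      positivity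
    · have hSy : S = {y} := Finset.eq_singleton_iff_unique_mem.2
        ⟨hy, fun x hx => Finset.card_le_one.1 (by omega) x hx y hy⟩
      subst hSy
      simp only [Finset.sum_singleton, abs_mul] at h0 ⊢
      have := hK [] (by simp) _ (hsv y hy)
      exact mul_le_mul h0 this (abs_nonneg _) hM
  | succ n ih =>
    intro f hd hK S hS hSθ w M hw s v hs0 hs1 hsv
    have h0 := hw 0 (by simp)
    have hM : 0 ≤ M := (abs_nonneg _).trans h0
    simp only [shiftedMonomial_zero, mul_one] at h0
    rcases S.eq_empty_or_nonempty with rfl | ⟨y, hy⟩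
    · simp only [Finset.sum_empty, abs_zero]
      positivity
    let pt : ℝ → Euc q → Euc q := fun t x => (s * t) • x + ((s * (1 - t)) • y + v)
    have hpt : ∀ t ∈ Set.Icc (0 : ℝ) 1, ∀ x ∈ S, pt t x ∈ D := by
      intro t ht x hx
      have := hD (hsv x hx) (hsv y hy) ht.1 (sub_nonneg.2 ht.2) (by ring)
      convert this using 1
      simp only [pt]
      module
    let ψ : ℝ → ℝ := fun t => ∑ x ∈ S, w x * f (pt t x)
    let ψ' : ℝ → ℝ := fun t => ∑ x ∈ S, w x * fderiv ℝ f (pt t x) (s • (x - y))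
    have hψ : ∀ t ∈ Set.Icc (0 : ℝ) 1, HasDerivAt ψ (ψ' t) t := by
      intro t ht
      refine HasDerivAt.fun_sum fun x hx => ?_
      refine HasDerivAt.const_mul (w x) ?_
      have hf : DifferentiableAt ℝ f (pt t x) := hd [] (by simp) _ (hpt t ht x hx)
      refine hf.hasFDerivAt.comp_hasDerivAt t ?_
      have h1 := ((hasDerivAt_id t).const_mul s).smul_const x
      have h2 := ((((hasDerivAt_id t).const_sub 1).const_mul s).smul_const y).add_const v
      exact (h1.add h2).congr_deriv (by module)
    have hbound : ∀ t ∈ Set.Icc (0 : ℝ) 1, |ψ' t| ≤ q * ((2 * q + 1) ^ n * (2 * M) * K) := by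
      intro t ht
      have hrepr : ψ' t = ∑ i, s * ∑ x ∈ S.erase y, w x * (x i - y i) *
          fderiv ℝ f ((s * t) • x + ((s * (1 - t)) • y + v)) (EuclideanSpace.single i 1) := by
        simp_rw [Finset.mul_sum]
        rw [Finset.sum_comm, Finset.sum_erase _ (by simp)]
        refine Finset.sum_congr rfl fun x _ => ?_
        have hx : s • (x - y) = ∑ i, (s * (x i - y i)) • EuclideanSpace.single i (1 : ℝ) := by
          ext j
          simp [Finset.sum_apply, Pi.single_apply]
        rw [hx, map_sum, Finset.mul_sum]
        refine Finset.sum_congr rfl fun i _ => ?_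
        rw [map_smul, smul_eq_mul]
        ring
      rw [hrepr]
      refine (Finset.abs_sum_le_sum_abs _ _).trans ?_
      have hterm : ∀ i ∈ (Finset.univ : Finset (Fin q)), |s * ∑ x ∈ S.erase y,
          w x * (x i - y i) * fderiv ℝ f ((s * t) • x + ((s * (1 - t)) • y + v))
            (EuclideanSpace.single i 1)| ≤ (2 * q + 1) ^ n * (2 * M) * K := by
        intro i _
        rw [abs_mul, abs_of_nonneg hs0]
        have := ih (fun x => fderiv ℝ f x (EuclideanSpace.single i 1))
          (fun l hl => hd (i :: l) (by simpa using hl))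
          (fun l hl => hK (i :: l) (by simpa using hl)) (S.erase y)
          (by rw [Finset.card_erase_of_mem hy]; omega)
          (fun x hx => hSθ x (Finset.mem_of_mem_erase hx))
          (fun x => w x * (x i - y i)) (2 * M) (by
            intro α hα
            rw [Finset.sum_erase _ (by simp), sum_coord_sub_mul_shiftedMonomial]
            refine (abs_sub _ _).trans ?_
            rw [abs_mul]
            have h1 := hw (α + Pi.single i 1) (by rw [sum_add_single]; omega)
            have h2 := hw α (by omega)
            have h3 := mul_le_mul (hSθ y hy i) h2 (abs_nonneg _) zero_le_one
            linarith) (s * t) ((s * (1 - t)) • y + v) (mul_nonneg hs0 ht.1)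
          (mul_le_one₀ hs1 ht.1 ht.2) (fun x hx => hpt t ht x (Finset.mem_of_mem_erase hx))
        exact (mul_le_of_le_one_left (abs_nonneg _) hs1).trans this
      refine (Finset.sum_le_sum hterm).trans (le_of_eq ?_)
      simp
    have hmv := norm_image_sub_le_of_norm_deriv_le_segment_01'
      (fun t ht => (hψ t ht).hasDerivWithinAt) (fun t ht => hbound t (Set.Ico_subset_Icc_self ht))
    have hψ1 : ψ 1 = ∑ x ∈ S, w x * f (s • x + v) := by simp [ψ, pt]
    have hψ0 : ψ 0 = (∑ x ∈ S, w x) * f (s • y + v) := by simp [ψ, pt, Finset.sum_mul]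
    have hψ0' : |ψ 0| ≤ M * K := by
      rw [hψ0, abs_mul]
      exact mul_le_mul h0 (hK [] (by simp) _ (hsv y hy)) (abs_nonneg _) hM
    have h1 : (1 : ℝ) ≤ (2 * q + 1) ^ n := one_le_pow₀ (by linarith [Nat.cast_nonneg (α := ℝ) q])
    rw [← hψ1]
    calc |ψ 1| ≤ |ψ 1 - ψ 0| + |ψ 0| := by
          simpa using abs_add_le (ψ 1 - ψ 0) (ψ 0)
      _ ≤ q * ((2 * q + 1) ^ n * (2 * M) * K) + M * K := add_le_add hmv hψ0'
      _ ≤ q * ((2 * q + 1) ^ n * (2 * M) * K) + (2 * q + 1) ^ n * (M * K) := by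
          refine add_le_add le_rfl ?_
          exact le_mul_of_one_le_left (mul_nonneg hM hK0) h1
      _ = (2 * q + 1) ^ (n + 1) * M * K := by ring

end MomentBounds

section Taylor

variable {q : ℕ}

lemma sum_count_eq_length (l : List (Fin q)) : ∑ i, l.count i = l.length := by
  induction l with
  | nil => simp
  | cons a l ih => simp [List.count_cons, Finset.sum_add_distrib, ih]

/-- Uniform Taylor expansion of the pairing of a function with signed weights carried by at most
`n + 1` points close to `θ`, the error being measured by the moments of the weights. -/
lemma exists_taylor_pairing {U : Set (Euc q)} (hU : IsOpen U) {n : ℕ} {f : Euc q → ℝ}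
    (hf : ContDiffOn ℝ n f U) {θ : Euc q} (hθ : θ ∈ U) {η : ℝ} (hη : 0 < η) :
    ∃ δ > 0, ∀ S : Finset (Euc q), S.card ≤ n + 1 → (∀ x ∈ S, x ∈ Metric.ball θ δ) →
      ∀ (w : Euc q → ℝ) (M : ℝ),
      (∀ α : Fin q → ℕ, ∑ i, α i ≤ n → |∑ x ∈ S, w x * shiftedMonomial θ α x| ≤ M) →
      |∑ x ∈ S, w x * f x - ∑ α ∈ multiIdx q n, Dmulti α f θ / (∏ i, ((α i).factorial : ℝ)) *
        ∑ x ∈ S, w x * shiftedMonomial θ α x| ≤ η * M := by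
  set c : (Fin q → ℕ) → ℝ := fun α => Dmulti α f θ / (∏ i, ((α i).factorial : ℝ)) with hc
  let T : Euc q → ℝ := fun x => ∑ α ∈ multiIdx q n, c α * shiftedMonomial θ α x
  let R : Euc q → ℝ := fun x => f x - T x
  have hT : ContDiff ℝ n T := ContDiff.sum fun α _ =>
    contDiff_const.mul (contDiff_shiftedMonomial θ α)
  have hR : ContDiffOn ℝ n R U := hf.sub hT.contDiffOn
  have hle : ∀ l : List (Fin q), l.length ≤ n → ((l.length : ℕ) : WithTop ℕ∞) ≤ (n : ℕ) :=
    fun l hl => by exact_mod_cast hl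
  have hRθ : ∀ l : List (Fin q), l.length ≤ n → pderivSeq l R θ = 0 := by
    intro l hl
    have h1 := pderivSeq_sub hU l (hf.of_le (hle l hl)) (hT.contDiffOn.of_le (hle l hl)) hθ
    have h2 := pderivSeq_eq_Dmulti hU (hf.of_le (hle l hl)) hθ
    have h3 := pderivSeq_sum_shiftedMonomial θ (multiIdx q n) l c id
    have hmem : (fun i => l.count i) ∈ multiIdx q n := by
      rw [mem_multiIdx]
      exact (sum_count_eq_length l).le.trans hl
    rw [Finset.sum_eq_single_of_mem _ hmem (fun α _ hα => by simp [hα])] at h3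
    refine h1.trans ?_
    change pderivSeq l f θ - pderivSeq l (fun x => ∑ j ∈ multiIdx q n, c j *
      shiftedMonomial θ (id j) x) θ = 0
    rw [h2, h3]
    simp only [id, if_true, hc]
    rw [div_mul_cancel₀, sub_self]
    exact Finset.prod_ne_zero_iff.2 fun i _ => by positivity
  set K : ℝ := η / (2 * q + 1) ^ n with hK
  have hKpos : 0 < K := by positivity
  have hsmall : ∀ᶠ x in nhds θ, ∀ l ∈ {l : List (Fin q) | l.length ≤ n}, |pderivSeq l R x| ≤ K := by
    rw [Filter.eventually_all_finite (List.finite_length_le _ n)]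
    intro l hl
    have hcont : ContDiffOn ℝ (0 : ℕ) (pderivSeq l R) U :=
      contDiffOn_pderivSeq hU 0 l (hR.of_le (hle l hl))
    have := (hcont.continuousOn.continuousAt (hU.mem_nhds hθ)).abs
    have h0 : |pderivSeq l R θ| < K := by rw [hRθ l hl]; simpa
    exact (this.eventually (gt_mem_nhds h0)).mono fun x hx => le_of_lt hx
  obtain ⟨δ, hδ, hball⟩ := Metric.eventually_nhds_iff_ball.1 (hsmall.and (hU.mem_nhds hθ))
  refine ⟨min δ 1, lt_min hδ one_pos, fun S hS hSθ w M hw => ?_⟩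
  have hD : ∀ x ∈ Metric.ball θ (min δ 1), x ∈ Metric.ball θ δ :=
    fun x hx => Metric.ball_subset_ball (min_le_left _ _) hx
  have key := abs_sum_mul_le_of_pderivSeq_bounded θ (convex_ball θ (min δ 1)) hKpos.le n R
    (fun l hl x hx => by
      have h1 : ContDiffOn ℝ (1 : ℕ) (pderivSeq l R) U := by
        refine contDiffOn_pderivSeq hU 1 l (hR.of_le ?_)
        exact_mod_cast hl
      exact (h1.differentiableOn (by simp)).differentiableAt (hU.mem_nhds (hball x (hD x hx)).2))
    (fun l hl x hx => (hball x (hD x hx)).1 l hl) S hS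
    (fun x hx i => by
      have h1 : ‖x - θ‖ < 1 := by
        have := hSθ x hx
        rw [Metric.mem_ball, dist_eq_norm] at this
        exact this.trans_le (min_le_right _ _)
      have h2 := PiLp.norm_apply_le (x - θ) i
      simp only [PiLp.sub_apply, Real.norm_eq_abs] at h2
      linarith)
    w M hw 1 0 zero_le_one le_rfl (fun x hx => by simpa using hSθ x hx)
  have hsum : ∑ x ∈ S, w x * R ((1 : ℝ) • x + 0) = ∑ x ∈ S, w x * f x -
      ∑ α ∈ multiIdx q n, c α * ∑ x ∈ S, w x * shiftedMonomial θ α x := by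
    simp only [one_smul, add_zero, R, T, mul_sub, Finset.sum_sub_distrib, Finset.mul_sum]
    congr 1
    rw [Finset.sum_comm]
    exact Finset.sum_congr rfl fun α _ => Finset.sum_congr rfl fun x _ => by ring
  rw [hsum] at key
  refine key.trans (le_of_eq ?_)
  rw [hK]
  field_simp

end Taylor

section Transport

variable {X : Type*} [PseudoMetricSpace X]

/-- `π` is a transport plan on the finite set `S` from the weights `g` to the weights `h`. -/
def IsPlan (S : Finset X) (g h : X → ℝ) (π : X → X → ℝ) : Prop :=
  (∀ x y, 0 ≤ π x y) ∧ (∀ x ∈ S, ∑ y ∈ S, π x y = g x) ∧ ∀ y ∈ S, ∑ x ∈ S, π x y = h y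

/-- The cost of a transport plan. -/
def planCost (S : Finset X) (p : ℕ) (π : X → X → ℝ) : ℝ :=
  ∑ x ∈ S, ∑ y ∈ S, π x y * dist x y ^ p

lemma exists_plan_trans {S : Finset X} (p : ℕ) {g g' h : X → ℝ} {π₁ π₂ : X → X → ℝ}
    (h₁ : IsPlan S g g' π₁) (h₂ : IsPlan S g' h π₂) :
    ∃ π, IsPlan S g h π ∧ planCost S p π ≤ 2 ^ p * (planCost S p π₁ + planCost S p π₂) := by
  obtain ⟨p1, r1, c1⟩ := h₁
  obtain ⟨p2, r2, c2⟩ := h₂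
  have hg' : ∀ y ∈ S, 0 ≤ g' y := fun y hy => r2 y hy ▸ Finset.sum_nonneg fun z _ => p2 y z
  have z1 : ∀ x ∈ S, ∀ y ∈ S, g' y = 0 → π₁ x y = 0 := fun x hx y hy h0 =>
    (Finset.sum_eq_zero_iff_of_nonneg fun u _ => p1 u y).1 ((c1 y hy).trans h0) x hx
  have z2 : ∀ y ∈ S, ∀ z ∈ S, g' y = 0 → π₂ y z = 0 := fun y hy z hz h0 =>
    (Finset.sum_eq_zero_iff_of_nonneg fun u _ => p2 y u).1 ((r2 y hy).trans h0) z hz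
  have s2 : ∀ x ∈ S, ∀ y ∈ S, ∑ z ∈ S, π₁ x y * π₂ y z / g' y = π₁ x y := by
    intro x hx y hy
    rw [← Finset.sum_div, ← Finset.mul_sum, r2 y hy]
    by_cases h0 : g' y = 0
    · simp [h0, z1 x hx y hy h0]
    · field_simp
  have s1 : ∀ z ∈ S, ∀ y ∈ S, ∑ x ∈ S, π₁ x y * π₂ y z / g' y = π₂ y z := by
    intro z hz y hy
    rw [← Finset.sum_div, ← Finset.sum_mul, c1 y hy]
    by_cases h0 : g' y = 0
    · simp [h0, z2 y hy z hz h0]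
    · field_simp
  refine ⟨fun x z => ∑ y ∈ S, π₁ x y * π₂ y z / g' y, ⟨?_, ?_, ?_⟩, ?_⟩
  · exact fun x z => Finset.sum_nonneg fun y hy =>
      div_nonneg (mul_nonneg (p1 _ _) (p2 _ _)) (hg' y hy)
  · intro x hx
    rw [Finset.sum_comm, ← r1 x hx]
    exact Finset.sum_congr rfl fun y hy => s2 x hx y hy
  · intro z hz
    rw [Finset.sum_comm, ← c2 z hz]
    exact Finset.sum_congr rfl fun y hy => s1 z hz y hy
  · have hd : ∀ x y z : X, dist x z ^ p ≤ 2 ^ p * (dist x y ^ p + dist y z ^ p) := by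
      intro x y z
      calc dist x z ^ p ≤ (dist x y + dist y z) ^ p := by
            gcongr
            exact dist_triangle x y z
        _ ≤ 2 ^ (p - 1) * (dist x y ^ p + dist y z ^ p) := add_pow_le dist_nonneg dist_nonneg p
        _ ≤ 2 ^ p * (dist x y ^ p + dist y z ^ p) := by
            gcongr
            · norm_num
            · omega
    have e1 : ∑ x ∈ S, ∑ z ∈ S, ∑ y ∈ S, π₁ x y * π₂ y z / g' y * dist x y ^ p
        = planCost S p π₁ := by
      refine Finset.sum_congr rfl fun x hx => ?_
      rw [Finset.sum_comm]
      refine Finset.sum_congr rfl fun y hy => ?_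
      rw [← Finset.sum_mul, s2 x hx y hy]
    have e2 : ∑ x ∈ S, ∑ z ∈ S, ∑ y ∈ S, π₁ x y * π₂ y z / g' y * dist y z ^ p
        = planCost S p π₂ := by
      unfold planCost
      rw [Finset.sum_comm, Finset.sum_comm (s := S) (t := S) (f := fun x y => π₂ x y * _)]
      refine Finset.sum_congr rfl fun z hz => ?_
      rw [Finset.sum_comm]
      refine Finset.sum_congr rfl fun y hy => ?_
      rw [← Finset.sum_mul, s1 z hz y hy]
    rw [← e1, ← e2, ← Finset.sum_add_distrib, Finset.mul_sum]
    unfold planCost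
    refine Finset.sum_le_sum fun x _ => ?_
    rw [← Finset.sum_add_distrib, Finset.mul_sum]
    refine Finset.sum_le_sum fun z _ => ?_
    rw [← Finset.sum_add_distrib, Finset.mul_sum, Finset.sum_mul]
    refine Finset.sum_le_sum fun y hy => ?_
    have hnn : 0 ≤ π₁ x y * π₂ y z / g' y := div_nonneg (mul_nonneg (p1 _ _) (p2 _ _)) (hg' y hy)
    calc π₁ x y * π₂ y z / g' y * dist x z ^ p
        ≤ π₁ x y * π₂ y z / g' y * (2 ^ p * (dist x y ^ p + dist y z ^ p)) :=
          mul_le_mul_of_nonneg_left (hd x y z) hnn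
      _ = _ := by ring

variable [DecidableEq X]

lemma exists_plan_refl (S : Finset X) {p : ℕ} (hp : p ≠ 0) {g : X → ℝ} (hg : ∀ x, 0 ≤ g x) :
    ∃ π, IsPlan S g g π ∧ planCost S p π = 0 := by
  refine ⟨fun x y => if x = y then g x else 0, ⟨?_, ?_, ?_⟩, ?_⟩
  · intro x y; dsimp only; split_ifs <;> simp [hg]
  · intro x hx; simp [hx]
  · intro x hx; simp [hx]
  · refine Finset.sum_eq_zero fun x _ => Finset.sum_eq_zero fun y _ => ?_
    by_cases h : x = y
    · subst h; simp [hp]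
    · simp [h]

lemma exists_plan_move {S : Finset X} {p : ℕ} (hp : p ≠ 0) {g : X → ℝ} (hg : ∀ x, 0 ≤ g x)
    {x y : X} (hx : x ∈ S) (hy : y ∈ S) {m : ℝ} (hm0 : 0 ≤ m) (hm : m ≤ g x) :
    ∃ π, IsPlan S g (fun z => g z - (if z = x then m else 0) + if z = y then m else 0) π ∧
      planCost S p π = m * dist x y ^ p := by
  refine ⟨fun u v => (if u = v then g u - (if u = x then m else 0) else 0) +
    if u = x then (if v = y then m else 0) else 0, ⟨?_, ?_, ?_⟩, ?_⟩
  · intro u v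
    refine add_nonneg ?_ ?_
    · split_ifs with h1 h2
      · subst h2; linarith
      · simpa using hg u
      · exact le_rfl
    · split_ifs <;> simp [hm0]
  · intro u hu
    rw [Finset.sum_add_distrib]
    by_cases h : u = x <;> simp [h, hx, hy, hu]
  · intro v hv
    rw [Finset.sum_add_distrib]
    simp [hx, hv]
  · unfold planCost
    simp_rw [add_mul, Finset.sum_add_distrib]
    have h0 : ∑ u ∈ S, ∑ v ∈ S, (if u = v then g u - (if u = x then m else 0) else 0) *
        dist u v ^ p = 0 := by
      refine Finset.sum_eq_zero fun u _ => Finset.sum_eq_zero fun v _ => ?_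
      by_cases h : u = v
      · subst h; simp [hp]
      · simp [h]
    rw [h0, zero_add, Finset.sum_eq_single_of_mem x hx (fun u _ hu => by simp [hu]),
      Finset.sum_eq_single_of_mem y hy (fun v _ hv => by simp [hv])]
    simp

/-- If the imbalance of every proper subset, weighted by a power of its distance to its complement,
is at most `N`, then the optimal transport cost is at most a multiple of `N`. -/
lemma exists_plan_of_separated_imbalance {p : ℕ} (hp : p ≠ 0) (n : ℕ) :
    ∃ C : ℝ, 0 ≤ C ∧ ∀ (S A : Finset X), A ⊆ S → A.card ≤ n + 1 → ∀ (g h : X → ℝ) (N : ℝ),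
      (∀ x, 0 ≤ g x) → (∀ x, 0 ≤ h x) → (∀ x ∉ A, g x = h x) →
      ∑ x ∈ A, (g x - h x) = 0 → 0 ≤ N →
      (∀ B ⊆ A, ∀ d : ℝ, 0 ≤ d → (∀ x ∈ B, ∀ y ∈ A \ B, d ≤ dist x y) → B.Nonempty →
        (A \ B).Nonempty → |∑ x ∈ B, (g x - h x)| * d ^ p ≤ N) →
      ∃ π, IsPlan S g h π ∧ planCost S p π ≤ C * N := by
  have base : ∀ (S A : Finset X) (g h : X → ℝ) (N : ℝ), (∀ x, 0 ≤ g x) →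
      (∀ x ∉ A, g x = h x) → ∑ x ∈ A, (g x - h x) = 0 → A.card ≤ 1 →
      ∃ π, IsPlan S g h π ∧ planCost S p π = 0 := by
    intro S A g h N hg hgh hsum hA
    have : h = g := by
      funext z
      by_cases hz : z ∈ A
      · have hAz : A = {z} := Finset.eq_singleton_iff_unique_mem.2
          ⟨hz, fun x hx => Finset.card_le_one.1 hA x hx z hz⟩
        rw [hAz, Finset.sum_singleton] at hsum
        linarith
      · exact (hgh z hz).symm
    subst this
    exact exists_plan_refl S hp hg
  induction n with
  | zero =>
    refine ⟨0, le_rfl, fun S A _ hA g h N hg _ hgh hsum _ _ => ?_⟩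
    obtain ⟨π, h1, h2⟩ := base S A g h N hg hgh hsum hA
    exact ⟨π, h1, by simp [h2]⟩
  | succ n ih =>
    obtain ⟨C, hC, ih⟩ := ih
    refine ⟨2 ^ p * (1 + C * 2 ^ p), by positivity, ?_⟩
    intro S A hAS hA g h N hg hh hgh hsum hN hsep
    by_cases hA1 : A.card ≤ 1
    · obtain ⟨π, h1, h2⟩ := base S A g h N hg hgh hsum hA1
      exact ⟨π, h1, by rw [h2]; positivity⟩
    push Not at hA1
    obtain ⟨x, hx, hwx⟩ : ∃ x ∈ A, 0 ≤ g x - h x := by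
      by_contra! hc
      have := Finset.sum_lt_sum_of_nonempty (Finset.card_pos.1 (by omega)) hc
      simp [hsum] at this
    have hcard := Finset.card_erase_of_mem hx
    have hne : (A.erase x).Nonempty := Finset.card_pos.1 (by omega)
    obtain ⟨y, hy, hymin⟩ := Finset.exists_min_image (A.erase x) (fun y => dist x y) hne
    have hyA := Finset.mem_of_mem_erase hy
    have hyx := Finset.ne_of_mem_erase hy
    set m := g x - h x with hm
    obtain ⟨π₁, hπ₁, hc₁⟩ := exists_plan_move hp hg (hAS hx) (hAS hyA) hwx
      (by linarith [hh x] : m ≤ g x)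
    set g' : X → ℝ := fun z => g z - (if z = x then m else 0) + if z = y then m else 0 with hg'
    have hg'x : g' x = h x := by simp [hg', hyx.symm, hm]
    have hg'y : g' y = g y + m := by simp [hg', hyx]
    have hg'o : ∀ z, z ≠ x → z ≠ y → g' z = g z := fun z h1 h2 => by simp [hg', h1, h2]
    have hmove : ∀ B : Finset X, x ∉ B → y ∈ B →
        ∑ z ∈ B, (g' z - h z) = ∑ z ∈ insert x B, (g z - h z) := by
      intro B hxB hyB
      rw [Finset.sum_insert hxB, ← Finset.add_sum_erase _ _ hyB,
        ← Finset.add_sum_erase B (fun z => g z - h z) hyB, hg'y]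
      have : ∑ z ∈ B.erase y, (g' z - h z) = ∑ z ∈ B.erase y, (g z - h z) :=
        Finset.sum_congr rfl fun z hz => by
          rw [hg'o z (fun hzx => hxB (hzx ▸ Finset.mem_of_mem_erase hz))
            (Finset.ne_of_mem_erase hz)]
      rw [this]
      ring
    have hsame : ∀ B : Finset X, x ∉ B → y ∉ B →
        ∑ z ∈ B, (g' z - h z) = ∑ z ∈ B, (g z - h z) := fun B hxB hyB =>
      Finset.sum_congr rfl fun z hz => by
        rw [hg'o z (fun hzx => hxB (hzx ▸ hz)) (fun hzy => hyB (hzy ▸ hz))]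
    have hhalf : ∀ (d : ℝ) (z : X), z ∈ A.erase x → d ≤ dist y z → d / 2 ≤ dist x z := by
      intro d z hz hd
      have h1 := hymin z hz
      have h2 := dist_triangle_left y z x
      linarith
    obtain ⟨π₂, hπ₂, hc₂⟩ := ih S (A.erase x) ((Finset.erase_subset _ _).trans hAS) (by omega) g' h
      (2 ^ p * N) (by
        intro z
        by_cases hzx : z = x
        · rw [hzx, hg'x]; exact hh x
        by_cases hzy : z = y
        · rw [hzy, hg'y]; linarith [hg y]
        rw [hg'o z hzx hzy]; exact hg z) hh (by
        intro z hz
        by_cases hzx : z = x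
        · rw [hzx, hg'x]
        · have hzA : z ∉ A := fun hzA => hz (Finset.mem_erase.2 ⟨hzx, hzA⟩)
          rw [hg'o z hzx (fun hzy => hzA (hzy ▸ hyA)), hgh z hzA])
      (by rw [hmove _ (Finset.notMem_erase x A) hy, Finset.insert_erase hx, hsum])
      (by positivity) (by
        intro B hB d hd hBsep hBne hBc
        have hxB : x ∉ B := fun h => Finset.notMem_erase x A (hB h)
        have hBA : B ⊆ A := hB.trans (Finset.erase_subset _ _)
        have hd2 : (d / 2) ^ p * 2 ^ p = d ^ p := by rw [← mul_pow]; congr 1; ring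
        by_cases hyB : y ∈ B
        · have hcompl : A \ insert x B = A.erase x \ B := by
            ext z; simp only [Finset.mem_sdiff, Finset.mem_insert, Finset.mem_erase]; tauto
          have := hsep (insert x B) (Finset.insert_subset hx hBA) (d / 2) (by positivity) (by
            rw [hcompl]
            intro u hu v hv
            rcases Finset.mem_insert.1 hu with rfl | hu
            · exact hhalf d v (Finset.mem_sdiff.1 hv).1 (hBsep y hyB v hv)
            · linarith [hBsep u hu v hv]) (Finset.insert_nonempty _ _) (hcompl ▸ hBc)
          rw [hmove B hxB hyB, ← hd2]
          nlinarith [pow_pos (two_pos : (0 : ℝ) < 2) p]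
        · have hyc : y ∈ A.erase x \ B := Finset.mem_sdiff.2 ⟨hy, hyB⟩
          have := hsep B hBA (d / 2) (by positivity) (by
            intro u hu v hv
            by_cases hvx : v = x
            · rw [hvx, dist_comm]
              exact hhalf d u (hB hu) (dist_comm u y ▸ hBsep u hu y hyc)
            · have := hBsep u hu v (Finset.mem_sdiff.2
                ⟨Finset.mem_erase.2 ⟨hvx, (Finset.mem_sdiff.1 hv).1⟩, (Finset.mem_sdiff.1 hv).2⟩)
              linarith) hBne ⟨x, Finset.mem_sdiff.2 ⟨hx, hxB⟩⟩
          rw [hsame B hxB hyB, ← hd2]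
          nlinarith [pow_pos (two_pos : (0 : ℝ) < 2) p])
    have hcost1 : planCost S p π₁ ≤ N := by
      have := hsep {x} (Finset.singleton_subset_iff.2 hx) (dist x y) dist_nonneg (by
        intro u hu v hv
        rw [Finset.mem_singleton.1 hu]
        rw [Finset.mem_sdiff, Finset.mem_singleton] at hv
        exact hymin v (Finset.mem_erase.2 ⟨hv.2, hv.1⟩)) (Finset.singleton_nonempty x)
        ⟨y, Finset.mem_sdiff.2 ⟨hyA, by simpa using hyx⟩⟩
      rwa [Finset.sum_singleton, abs_of_nonneg hwx, ← hc₁] at this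
    obtain ⟨π, hπ, hc⟩ := exists_plan_trans p hπ₁ hπ₂
    refine ⟨π, hπ, hc.trans ?_⟩
    calc 2 ^ p * (planCost S p π₁ + planCost S p π₂) ≤ 2 ^ p * (N + C * (2 ^ p * N)) := by gcongr
      _ = _ := by ring

end Transport

section Wasserstein

variable {q : ℕ}

lemma Wpow_le_planCost {G H : Euc q →₀ ℝ} {S : Finset (Euc q)} (hG : G.support ⊆ S)
    (hH : H.support ⊆ S) (p : ℕ) {π : Euc q → Euc q → ℝ} (hπ : IsPlan S G H π) :
    Wpow (p : ℝ) G H ≤ planCost S p π := by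
  obtain ⟨h0, hr, hc⟩ := hπ
  have zr : ∀ x ∈ S, ∀ y ∈ S, x ∉ G.support → π x y = 0 := fun x hx y hy hxG =>
    (Finset.sum_eq_zero_iff_of_nonneg fun u _ => h0 x u).1
      ((hr x hx).trans (Finsupp.notMem_support_iff.1 hxG)) y hy
  have zc : ∀ x ∈ S, ∀ y ∈ S, y ∉ H.support → π x y = 0 := fun x hx y hy hyH =>
    (Finset.sum_eq_zero_iff_of_nonneg fun u _ => h0 u y).1
      ((hc y hy).trans (Finsupp.notMem_support_iff.1 hyH)) x hx
  refine csInf_le ⟨0, ?_⟩ ⟨fun z => π z.1 z.2, ⟨fun z => h0 _ _, ?_, ?_⟩, ?_⟩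
  · rintro _ ⟨ρ, hρ, rfl⟩
    exact Finset.sum_nonneg fun z _ => mul_nonneg (hρ.1 z) (Real.rpow_nonneg (norm_nonneg _) _)
  · intro x hx
    rw [← hr x (hG hx)]
    exact Finset.sum_subset hH fun y hy hyH => zc x (hG hx) y hy hyH
  · intro y hy
    rw [← hc y (hH hy)]
    exact Finset.sum_subset hG fun x hx hxG => zr x hx y (hH hy) hxG
  · rw [Finset.sum_product]
    simp only [Real.rpow_natCast, ← dist_eq_norm]
    unfold planCost
    rw [← Finset.sum_subset hG fun x hx hxG =>
      Finset.sum_eq_zero fun y hy => by rw [zr x hx y hy hxG, zero_mul]]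
    refine Finset.sum_congr rfl fun x hx => ?_
    exact (Finset.sum_subset hH fun y hy hyH => by rw [zc x (hG hx) y hy hyH, zero_mul]).symm

lemma mul_le_Wpow_one {Θ Θ' : Set (Euc q)} {G G₀ : Euc q →₀ ℝ} (hG : IsMixingMeasure Θ G)
    (hG₀ : IsMixingMeasure Θ' G₀) {s : Euc q} (hs : s ∈ G₀.support) {ρ : ℝ}
    (hρ : ∀ x ∈ G.support, ρ ≤ ‖x - s‖) : ρ * G₀ s ≤ Wpow 1 G G₀ := by
  refine le_csInf ⟨_, fun z => |G z.1 * G₀ z.2|, ⟨fun z => abs_nonneg _, ?_, ?_⟩, rfl⟩ ?_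
  · intro x hx
    rw [Finset.sum_congr rfl fun y hy =>
      abs_of_pos (mul_pos (hG.1 x hx) (hG₀.1 y hy)), ← Finset.mul_sum, hG₀.2.1, mul_one]
  · intro y hy
    rw [Finset.sum_congr rfl fun x hx =>
      abs_of_pos (mul_pos (hG.1 x hx) (hG₀.1 y hy)), ← Finset.sum_mul, hG.2.1, one_mul]
  · rintro _ ⟨π, ⟨h0, _, hc⟩, rfl⟩
    rw [Finset.sum_product, ← hc s hs, Finset.mul_sum]
    refine Finset.sum_le_sum fun x hx => ?_
    calc ρ * π (x, s) ≤ π (x, s) * ‖x - s‖ ^ (1 : ℝ) := by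
          rw [Real.rpow_one, mul_comm]
          exact mul_le_mul_of_nonneg_left (hρ x hx) (h0 _)
      _ ≤ _ := Finset.single_le_sum
          (f := fun y => π (x, y) * ‖x - y‖ ^ (1 : ℝ))
          (fun y _ => mul_nonneg (h0 _) (Real.rpow_nonneg (norm_nonneg _) _)) hs

lemma mixInt_sub_mixInt {G H : Euc q →₀ ℝ} {S : Finset (Euc q)} (hG : G.support ⊆ S)
    (hH : H.support ⊆ S) (φ : Euc q → ℝ) :
    mixInt G φ - mixInt H φ = ∑ x ∈ S, (G x - H x) * φ x := by
  have h : ∀ {F : Euc q →₀ ℝ}, F.support ⊆ S → mixInt F φ = ∑ x ∈ S, F x * φ x := fun hF =>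
    Finset.sum_subset hF fun x _ hx => by rw [Finsupp.notMem_support_iff.1 hx, zero_mul]
  rw [h hG, h hH, ← Finset.sum_sub_distrib]
  exact Finset.sum_congr rfl fun x _ => by ring

lemma IsMixingMeasure.nonneg {Θ : Set (Euc q)} {G : Euc q →₀ ℝ} (hG : IsMixingMeasure Θ G)
    (x : Euc q) : 0 ≤ G x := by
  by_cases hx : x ∈ G.support
  · exact (hG.1 x hx).le
  · rw [Finsupp.notMem_support_iff.1 hx]

lemma IsMixingMeasure.sum_sub_eq_zero {Θ : Set (Euc q)} {G H : Euc q →₀ ℝ}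
    (hG : IsMixingMeasure Θ G) (hH : IsMixingMeasure Θ H) {S : Finset (Euc q)}
    (hGS : G.support ⊆ S) (hHS : H.support ⊆ S) : ∑ x ∈ S, (G x - H x) = 0 := by
  have := mixInt_sub_mixInt hGS hHS fun _ => 1
  simp only [mixInt, mul_one] at this
  rw [← this, hG.2.1, hH.2.1, sub_self]

/-- The transport cost between two measures carried by clusters of points is controlled by the
moments of their difference on the clusters. -/
lemma exists_Wpow_le_moments {p : ℕ} (hp : p ≠ 0) {D : ℝ} (hD : 1 ≤ D) (T : Finset (Euc q))
    {m : Euc q → ℕ} (hm : ∀ τ ∈ T, m τ ≤ p + 1) :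
    ∃ C : ℝ, 0 ≤ C ∧ ∀ (S : Euc q → Finset (Euc q)) (G H : Euc q →₀ ℝ),
      (∀ τ ∈ T, (S τ).card ≤ m τ) → (T : Set (Euc q)).PairwiseDisjoint S →
      (∀ τ ∈ T, ∀ x ∈ S τ, ∀ i, |x i - τ i| ≤ 1) →
      (∀ x ∈ T.biUnion S, ∀ y ∈ T.biUnion S, dist x y ≤ D) →
      G.support ⊆ T.biUnion S → H.support ⊆ T.biUnion S → (∀ x, 0 ≤ G x) → (∀ x, 0 ≤ H x) →
      ∑ x ∈ T.biUnion S, (G x - H x) = 0 → ∀ M : ℝ, 0 ≤ M →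
      (∀ τ ∈ T, ∀ α : Fin q → ℕ, ∑ i, α i ≤ m τ - 1 →
        |∑ x ∈ S τ, (G x - H x) * shiftedMonomial τ α x| ≤ M) →
      Wpow (p : ℝ) G H ≤ C * M := by
  obtain ⟨C, hC, hplan⟩ := exists_plan_of_separated_imbalance (X := Euc q) hp (T.card * (p + 1))
  refine ⟨C * (T.card * ((4 * q + 1) ^ p * D ^ p)), by positivity, ?_⟩
  intro S G H hcard hdisj hcoord hdist hG hH hG0 hH0 hsum M hM hmom
  have hD0 : 0 < D := by linarith
  obtain ⟨π, hπ, hcost⟩ := hplan (T.biUnion S) (T.biUnion S) subset_rfl (by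
      have h1 : (T.biUnion S).card ≤ T.card * (p + 1) :=
        Finset.card_biUnion_le_card_mul _ _ _ fun τ hτ => (hcard τ hτ).trans (hm τ hτ)
      omega) G H (T.card * ((4 * q + 1) ^ p * D ^ p) * M) hG0 hH0 (by
      intro x hx
      rw [Finsupp.notMem_support_iff.1 fun h => hx (hG h),
        Finsupp.notMem_support_iff.1 fun h => hx (hH h)]) hsum (by positivity) (by
      intro B hB d hd hsep hBne hBc
      rcases hd.eq_or_lt with rfl | hd
      · rw [zero_pow hp, mul_zero]; positivity
      have hdD : d ≤ D := by
        obtain ⟨x, hx⟩ := hBne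
        obtain ⟨y, hy⟩ := hBc
        exact (hsep x hx y hy).trans (hdist x (hB hx) y (Finset.mem_sdiff.1 hy).1)
      have hε : 0 < d / D := by positivity
      have hε1 : d / D ≤ 1 := (div_le_one hD0).2 hdD
      have hεd : d / D ≤ d := div_le_self hd.le hD
      have hsplit : ∑ x ∈ B, (G x - H x) = ∑ τ ∈ T, ∑ x ∈ S τ ∩ B, (G x - H x) := by
        rw [← Finset.sum_biUnion]
        · congr 1
          ext x
          have := @hB x
          simp only [Finset.mem_biUnion, Finset.mem_inter] at this ⊢
          tauto
        · intro τ hτ τ' hτ' hne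
          exact (hdisj hτ hτ' hne).mono Finset.inter_subset_left Finset.inter_subset_left
      have hcluster : ∀ τ ∈ T, |∑ x ∈ S τ ∩ B, (G x - H x)| * d ^ p ≤
          (4 * q + 1) ^ p * D ^ p * M := by
        intro τ hτ
        have hn : m τ - 1 ≤ p := by have := hm τ hτ; omega
        have h := abs_sum_mul_pow_le_of_separated τ hε hε1 (m τ - 1) (S τ ∩ B) (S τ \ B)
          (by
            have h1 := Finset.card_inter_add_card_sdiff (S τ) B
            have h2 := hcard τ hτ
            omega)
          (fun a ha => hcoord τ hτ a (Finset.mem_inter.1 ha).1)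
          (fun b hb => hcoord τ hτ b (Finset.mem_sdiff.1 hb).1)
          (fun a ha b hb => by
            rw [← dist_eq_norm]
            refine hεd.trans (hsep a (Finset.mem_inter.1 ha).2 b ?_)
            rw [Finset.mem_sdiff] at hb ⊢
            exact ⟨Finset.mem_biUnion.2 ⟨τ, hτ, hb.1⟩, hb.2⟩)
          (fun x => G x - H x) M (fun α hα => by
            rw [Finset.sum_inter_add_sum_sdiff]
            exact hmom τ hτ α hα)
        have hq1 : (1 : ℝ) ≤ 4 * q + 1 := by linarith [Nat.cast_nonneg (α := ℝ) q]
        calc |∑ x ∈ S τ ∩ B, (G x - H x)| * d ^ p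
            = |∑ x ∈ S τ ∩ B, (G x - H x)| * (d / D) ^ p * D ^ p := by
              rw [div_pow]; field_simp
          _ ≤ |∑ x ∈ S τ ∩ B, (G x - H x)| * (d / D) ^ (m τ - 1) * D ^ p := by
              gcongr ?_ * ?_ * _
              exact pow_le_pow_of_le_one hε.le hε1 hn
          _ ≤ (4 * q + 1) ^ (m τ - 1) * M * D ^ p := by gcongr
          _ ≤ (4 * q + 1) ^ p * M * D ^ p := by gcongr
          _ = _ := by ring
      calc |∑ x ∈ B, (G x - H x)| * d ^ p
          ≤ (∑ τ ∈ T, |∑ x ∈ S τ ∩ B, (G x - H x)|) * d ^ p := by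
            rw [hsplit]
            gcongr
            exact Finset.abs_sum_le_sum_abs _ _
        _ = ∑ τ ∈ T, |∑ x ∈ S τ ∩ B, (G x - H x)| * d ^ p := Finset.sum_mul _ _ _
        _ ≤ ∑ τ ∈ T, (4 * q + 1) ^ p * D ^ p * M := Finset.sum_le_sum hcluster
        _ = _ := by rw [Finset.sum_const, nsmul_eq_mul]; ring)
  refine (Wpow_le_planCost hG hH p hπ).trans (hcost.trans (le_of_eq ?_))
  ring

end Wasserstein

section Compactness

variable {q : ℕ}

lemma LinIndepDomain.eq_zero_of_finset {Θ : Set (Euc q)} {Φ : Set (Euc q → ℝ)} {n k₀ k : ℕ}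
    (hΦ : LinIndepDomain Θ Φ n k₀ k) {T : Finset (Euc q)} (hTΘ : ∀ τ ∈ T, τ ∈ Θ)
    (hT : k₀ ≤ T.card) (hT' : T.card ≤ 2 * k - k₀) {m : Euc q → ℕ} (hm1 : ∀ τ ∈ T, 1 ≤ m τ)
    (hm : ∀ τ ∈ T, m τ ≤ n + 1) (hsum : 2 * k₀ ≤ ∑ τ ∈ T, m τ) (hsum' : ∑ τ ∈ T, m τ ≤ 2 * k)
    {b : Euc q → (Fin q → ℕ) → ℝ}
    (hb : ∀ φ ∈ Φ, ∑ τ ∈ T, ∑ α ∈ multiIdx q (m τ - 1), b τ α * Dmulti α φ τ = 0)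
    (hb0 : ∑ τ ∈ T, b τ 0 = 0) :
    ∀ τ ∈ T, ∀ α ∈ multiIdx q (m τ - 1), b τ α = 0 := by
  have hconv : ∀ {R : Type} [AddCommMonoid R] (F : Euc q → R),
      ∑ i, F (T.equivFin.symm i) = ∑ τ ∈ T, F τ := by
    intro R _ F
    rw [Equiv.sum_comp T.equivFin.symm (fun x : T => F x), Finset.sum_coe_sort]
  intro τ hτ α hα
  have := hΦ.2 T.card hT hT' (fun i => m (T.equivFin.symm i)) (fun i => hm1 _ (Subtype.prop _))
    (fun i => hm _ (Subtype.prop _)) (by rwa [hconv m]) (by rwa [hconv m])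
    (fun i => T.equivFin.symm i) (Subtype.val_injective.comp T.equivFin.symm.injective)
    (fun i => hTΘ _ (Subtype.prop _)) (fun i => b (T.equivFin.symm i))
    (fun φ hφ => by
      rw [hconv fun τ => ∑ α ∈ multiIdx q (m τ - 1), b τ α * Dmulti α φ τ]
      exact hb φ hφ)
    (by rwa [hconv fun τ => b τ 0]) (T.equivFin ⟨τ, hτ⟩) α
  simp only [Equiv.symm_apply_apply] at this
  exact this hα

lemma exists_fin_image_eq {X : Type*} [DecidableEq X] {s : Finset X} (hs : s.Nonempty) {k : ℕ}
    (hk : s.card ≤ k) : ∃ e : Fin k → X, Finset.univ.image e = s := by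
  obtain ⟨f⟩ : Nonempty (s ↪ Fin k) := Function.Embedding.nonempty_of_card_le (by simpa)
  have : Nonempty s := hs.to_subtype
  refine ⟨fun i => (Function.invFun (f : s → Fin k) i : s), ?_⟩
  ext x
  simp only [Finset.mem_image, Finset.mem_univ, true_and]
  constructor
  · rintro ⟨i, rfl⟩; exact Subtype.prop _
  · intro hx
    obtain ⟨i, hi⟩ := Function.invFun_surjective f.injective ⟨x, hx⟩
    exact ⟨i, by rw [hi]⟩

lemma IsMixingMeasure.support_nonempty {Θ : Set (Euc q)} {G : Euc q →₀ ℝ}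
    (hG : IsMixingMeasure Θ G) : G.support.Nonempty := by
  rw [Finset.nonempty_iff_ne_empty]
  intro h
  have := hG.2.1
  rw [h] at this
  simp at this

/-- If the measures `G n` converge to `G₀`, then some atom of `G n` converges to each atom
of `G₀`. -/
lemma exists_tendsto_atom {Θ : Set (Euc q)} {G₀ : Euc q →₀ ℝ} (hG₀ : IsMixingMeasure Θ G₀)
    {k : ℕ} {𝒰 : Ultrafilter ℕ} (h𝒰 : (𝒰 : Filter ℕ) ≤ Filter.atTop)
    {G : ℕ → Euc q →₀ ℝ} (hG : ∀ n, IsMixingMeasure Θ (G n))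
    (hW : ∀ n, Wpow 1 (G n) G₀ ≤ 1 / ((n : ℝ) + 1)) {x : ℕ → Fin k → Euc q}
    (hx : ∀ n, Finset.univ.image (x n) = (G n).support) {y : Fin k → Euc q}
    (hy : ∀ j, Filter.Tendsto (fun n => x n j) 𝒰 (nhds (y j))) {s : Euc q}
    (hs : s ∈ G₀.support) : ∃ j, y j = s := by
  by_contra! hne
  have hρ : ∃ ρ > 0, ∀ j, ρ < dist (y j) s := by
    have h : ∀ᶠ ρ in nhdsWithin (0 : ℝ) (Set.Ioi 0), ∀ j, ρ < dist (y j) s :=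
      Filter.eventually_all.2 fun j =>
        nhdsWithin_le_nhds (gt_mem_nhds (dist_pos.2 (hne j)))
    obtain ⟨ρ, h1, h2⟩ := (h.and self_mem_nhdsWithin).exists
    exact ⟨ρ, h2, h1⟩
  obtain ⟨ρ, hρ0, hρ⟩ := hρ
  have hpos : 0 < ρ * G₀ s := mul_pos hρ0 (hG₀.1 s hs)
  have h1 : ∀ᶠ n in (𝒰 : Filter ℕ), ∀ j, ρ < dist (x n j) s :=
    Filter.eventually_all.2 fun j =>
      ((hy j).dist tendsto_const_nhds).eventually (lt_mem_nhds (hρ j))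
  have h2 : ∀ᶠ n : ℕ in (𝒰 : Filter ℕ), 1 / ((n : ℝ) + 1) < ρ * G₀ s :=
    h𝒰 (tendsto_one_div_add_atTop_nhds_zero_nat.eventually (gt_mem_nhds hpos))
  obtain ⟨n, hn1, hn2⟩ := (h1.and h2).exists
  have := mul_le_Wpow_one (hG n) hG₀ hs (ρ := ρ) (fun z hz => by
    rw [← hx n] at hz
    obtain ⟨j, -, rfl⟩ := Finset.mem_image.1 hz
    rw [← dist_eq_norm]
    exact (hn1 j).le)
  linarith [hW n]

end Compactness

section MomentLimit

variable {q : ℕ}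

/-- A renormalised limit of the moments of the weights `w n` on clusters `S n τ` shrinking to `τ`,
together with the linear relations it inherits from test functions. -/
lemma exists_moment_limit {𝒰 : Ultrafilter ℕ} {p : ℕ} {T : Finset (Euc q)} {m : Euc q → ℕ}
    (hm : ∀ τ ∈ T, m τ ≤ p + 1) (hm1 : ∀ τ ∈ T, 1 ≤ m τ) {S : ℕ → Euc q → Finset (Euc q)}
    {w : ℕ → Euc q → ℝ} (hcard : ∀ n, ∀ τ ∈ T, (S n τ).card ≤ m τ)
    (hball : ∀ δ > 0, ∀ᶠ n in (𝒰 : Filter ℕ), ∀ τ ∈ T, ∀ x ∈ S n τ, x ∈ Metric.ball τ δ)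
    {N : ℕ → ℝ} (hN : ∀ n, N n = ∑ τ ∈ T, ∑ α ∈ multiIdx q (m τ - 1),
      |∑ x ∈ S n τ, w n x * shiftedMonomial τ α x|)
    (hNpos : ∀ᶠ n in (𝒰 : Filter ℕ), 0 < N n) {Φ : Set (Euc q → ℝ)}
    (hΦ : ∀ φ ∈ Φ, ∃ U : Set (Euc q), IsOpen U ∧ ↑T ⊆ U ∧ ContDiffOn ℝ p φ U)
    {ε : ℕ → ℝ} (hε : Filter.Tendsto ε 𝒰 (nhds 0))
    (hsmall : ∀ φ ∈ Φ, ∀ᶠ n in (𝒰 : Filter ℕ),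
      |∑ τ ∈ T, ∑ x ∈ S n τ, w n x * φ x| ≤ ε n * N n) :
    ∃ b : Euc q → (Fin q → ℕ) → ℝ,
      (∑ τ ∈ T, ∑ α ∈ multiIdx q (m τ - 1), |b τ α| = 1) ∧
      (∀ φ ∈ Φ, ∑ τ ∈ T, ∑ α ∈ multiIdx q (m τ - 1),
        b τ α / (∏ i, ((α i).factorial : ℝ)) * Dmulti α φ τ = 0) ∧
      ∀ τ ∈ T, ∀ α ∈ multiIdx q (m τ - 1), Filter.Tendsto
        (fun n => (∑ x ∈ S n τ, w n x * shiftedMonomial τ α x) / N n) 𝒰 (nhds (b τ α)) := by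
  set mom : ℕ → Euc q → (Fin q → ℕ) → ℝ :=
    fun n τ α => ∑ x ∈ S n τ, w n x * shiftedMonomial τ α x
  have hN0 : ∀ n, 0 ≤ N n := fun n => by
    rw [hN]; exact Finset.sum_nonneg fun τ _ => Finset.sum_nonneg fun α _ => abs_nonneg _
  have hle : ∀ n, ∀ τ ∈ T, ∀ α ∈ multiIdx q (m τ - 1), |mom n τ α| ≤ N n := by
    intro n τ hτ α hα
    rw [hN]
    refine le_trans ?_ (Finset.single_le_sum (fun τ _ =>
      Finset.sum_nonneg fun α _ => abs_nonneg (mom n τ α)) hτ)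
    exact Finset.single_le_sum (f := fun α => |mom n τ α|) (fun α _ => abs_nonneg _) hα
  have hlim : ∀ τ α, ∃ b : ℝ, τ ∈ T → α ∈ multiIdx q (m τ - 1) →
      Filter.Tendsto (fun n => mom n τ α / N n) 𝒰 (nhds b) := by
    intro τ α
    by_cases h : τ ∈ T ∧ α ∈ multiIdx q (m τ - 1)
    · obtain ⟨b, -, hb⟩ := (isCompact_Icc (a := (-1 : ℝ)) (b := 1)).ultrafilter_le_nhds
        (𝒰.map fun n => mom n τ α / N n) (by
          refine Filter.le_principal_iff.2 (Filter.mem_map.2 (Filter.Eventually.of_forall ?_))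
          intro n
          change mom n τ α / N n ∈ Set.Icc (-1 : ℝ) 1
          rw [Set.mem_Icc, ← abs_le, abs_div, abs_of_nonneg (hN0 n)]
          exact div_le_one_of_le₀ (hle n τ h.1 α h.2) (hN0 n))
      exact ⟨b, fun _ _ => hb⟩
    · exact ⟨0, fun h1 h2 => (h ⟨h1, h2⟩).elim⟩
  choose b hb using hlim
  refine ⟨b, ?_, ?_, fun τ hτ α hα => hb τ α hτ hα⟩
  · refine tendsto_nhds_unique (tendsto_finsetSum T fun τ hτ =>
      tendsto_finsetSum (multiIdx q (m τ - 1)) fun α hα => (hb τ α hτ hα).abs) ?_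
    refine tendsto_const_nhds.congr' (hNpos.mono fun n hn => ?_)
    simp only [abs_div, abs_of_pos hn, ← Finset.sum_div]
    rw [← hN, div_self hn.ne']
  · intro φ hφ
    obtain ⟨U, hU, hTU, hφU⟩ := hΦ φ hφ
    have hQ := tendsto_finsetSum T fun τ hτ =>
      tendsto_finsetSum (multiIdx q (m τ - 1)) fun α hα =>
        ((hb τ α hτ hα).div_const (∏ i, ((α i).factorial : ℝ))).mul_const (Dmulti α φ τ)
    refine tendsto_nhds_unique hQ ?_
    rw [Metric.tendsto_nhds]
    intro e he
    set η : ℝ := e / (2 * (T.card + 1)) with hη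
    have hη0 : 0 < η := by positivity
    have hTη : T.card * η < e / 2 := by
      have : (T.card : ℝ) * η = e / 2 * (T.card / (T.card + 1)) := by rw [hη]; field_simp
      rw [this]
      refine mul_lt_of_lt_one_right (by positivity) ((div_lt_one (by positivity)).2 (by linarith))
    have htay : ∀ τ, ∃ δ > 0, τ ∈ T → ∀ n, (∀ x ∈ S n τ, x ∈ Metric.ball τ δ) →
        |∑ x ∈ S n τ, w n x * φ x - ∑ α ∈ multiIdx q (m τ - 1),
          Dmulti α φ τ / (∏ i, ((α i).factorial : ℝ)) * mom n τ α| ≤ η * N n := by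
      intro τ
      by_cases hτ : τ ∈ T
      · have h1 := hm τ hτ
        have h2 := hm1 τ hτ
        obtain ⟨δ, hδ, h⟩ := exists_taylor_pairing (n := m τ - 1) hU
          (hφU.of_le (by exact_mod_cast (by omega : m τ - 1 ≤ p))) (hTU hτ) hη0
        refine ⟨δ, hδ, fun _ n hx => h (S n τ) ?_ hx (w n) (N n) ?_⟩
        · have := hcard n τ hτ
          omega
        · exact fun α hα => hle n τ hτ α (mem_multiIdx.2 hα)
      · exact ⟨1, one_pos, fun h => (hτ h).elim⟩
    choose δ hδ htay using htay
    have hballs : ∀ᶠ n in (𝒰 : Filter ℕ), ∀ τ ∈ T, ∀ x ∈ S n τ, x ∈ Metric.ball τ (δ τ) := by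
      refine (Filter.eventually_all_finset T).2 fun τ hτ => ?_
      exact (hball (δ τ) (hδ τ)).mono fun n hn => hn τ hτ
    filter_upwards [hballs, hNpos, hsmall φ hφ, hε.eventually (gt_mem_nhds (half_pos he))]
      with n hn1 hn2 hn3 hn4
    have key : |∑ τ ∈ T, ∑ α ∈ multiIdx q (m τ - 1),
        Dmulti α φ τ / (∏ i, ((α i).factorial : ℝ)) * mom n τ α| ≤
        T.card * (η * N n) + ε n * N n := by
      have h1 : |∑ τ ∈ T, (∑ x ∈ S n τ, w n x * φ x - ∑ α ∈ multiIdx q (m τ - 1),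
          Dmulti α φ τ / (∏ i, ((α i).factorial : ℝ)) * mom n τ α)| ≤ T.card * (η * N n) := by
        rw [← nsmul_eq_mul]
        exact (Finset.abs_sum_le_sum_abs _ _).trans
          (Finset.sum_le_card_nsmul _ _ _ fun τ hτ => htay τ hτ n (hn1 τ hτ))
      rw [Finset.sum_sub_distrib] at h1
      rw [abs_le] at *
      constructor <;> linarith
    have heq : ∑ τ ∈ T, ∑ α ∈ multiIdx q (m τ - 1),
        mom n τ α / N n / (∏ i, ((α i).factorial : ℝ)) * Dmulti α φ τ =
        (∑ τ ∈ T, ∑ α ∈ multiIdx q (m τ - 1),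
          Dmulti α φ τ / (∏ i, ((α i).factorial : ℝ)) * mom n τ α) / N n := by
      simp only [Finset.sum_div]
      refine Finset.sum_congr rfl fun τ _ => Finset.sum_congr rfl fun α _ => ?_
      ring
    rw [dist_zero_right, Real.norm_eq_abs, heq, abs_div, abs_of_pos hn2, div_lt_iff₀ hn2]
    nlinarith

end MomentLimit

section Multiplicity

/-- Multiplicities of the values of a function on `Fin k ⊕ Fin k` whose two halves both hit every
point of a given set. -/
lemma multiplicity_bounds {X : Type*} [DecidableEq X] {k : ℕ} {y : Fin k ⊕ Fin k → X}
    {A : Finset X} (hl : ∀ s ∈ A, ∃ j, y (Sum.inl j) = s) (hr : ∀ s ∈ A, ∃ j, y (Sum.inr j) = s)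
    {m : X → ℕ} (hm : ∀ τ, m τ = (Finset.univ.filter fun j => y j = τ).card) :
    A.card ≤ (Finset.univ.image y).card ∧ (Finset.univ.image y).card ≤ 2 * k - A.card ∧
      (∀ τ ∈ Finset.univ.image y, 1 ≤ m τ) ∧
      (∀ τ ∈ Finset.univ.image y, m τ ≤ 2 * (k - A.card + 1)) ∧
      ∑ τ ∈ Finset.univ.image y, m τ = 2 * k := by
  set T := Finset.univ.image y
  have hAT : A ⊆ T := fun s hs => by
    obtain ⟨j, hj⟩ := hl s hs
    exact Finset.mem_image.2 ⟨_, Finset.mem_univ _, hj⟩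
  have hsum : ∑ τ ∈ T, m τ = 2 * k := by
    rw [Finset.sum_congr rfl fun τ _ => hm τ, ← Finset.card_eq_sum_card_image]
    simp [two_mul]
  have h1 : ∀ τ ∈ T, 1 ≤ m τ := fun τ hτ => by
    obtain ⟨j, -, hj⟩ := Finset.mem_image.1 hτ
    rw [hm, Nat.succ_le_iff, Finset.card_pos]
    exact ⟨j, Finset.mem_filter.2 ⟨Finset.mem_univ _, hj⟩⟩
  have h2 : ∀ s ∈ A, 2 ≤ m s := fun s hs => by
    obtain ⟨j, hj⟩ := hl s hs
    obtain ⟨j', hj'⟩ := hr s hs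
    rw [hm, Nat.succ_le_iff, Finset.one_lt_card]
    exact ⟨Sum.inl j, by simpa using hj, Sum.inr j', by simpa using hj', by simp⟩
  have hA := Finset.card_le_card hAT
  have hA2 : A.card * 2 ≤ ∑ s ∈ A, m s := by
    simpa using Finset.card_nsmul_le_sum A m 2 h2
  have hTA : (T \ A).card * 1 ≤ ∑ s ∈ T \ A, m s := by
    simpa only [smul_eq_mul] using
      Finset.card_nsmul_le_sum (T \ A) m 1 fun s hs => h1 s (Finset.mem_sdiff.1 hs).1
  have hsplit := Finset.sum_sdiff (f := m) hAT
  have hc := Finset.card_sdiff_add_card_eq_card hAT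
  refine ⟨hA, by omega, h1, fun τ hτ => ?_, hsum⟩
  have h3 : (A.erase τ).card * 2 ≤ ∑ s ∈ A.erase τ, m s := by
    simpa using Finset.card_nsmul_le_sum (A.erase τ) m 2 fun s hs =>
      h2 s (Finset.mem_of_mem_erase hs)
  have h4 : ∑ s ∈ A.erase τ, m s ≤ ∑ s ∈ T.erase τ, m s :=
    Finset.sum_le_sum_of_subset (Finset.erase_subset_erase _ hAT)
  have h5 := Finset.add_sum_erase T m hτ
  have h6 := Finset.pred_card_le_card_erase (s := A) (a := τ)
  omega

end Multiplicity

/-- a `(2d1-1, k0, k)` linear independent domain satisfies the local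
inverse bound at every `G0 ∈ E_{k0}(Θ)`. -/
theorem local_inverse_bound_of_lin_indep_domain {q k k0 : ℕ} (hk0 : 1 ≤ k0) (hk0k : k0 ≤ k)
    (Θ : Set (Euc q)) (hΘ : IsCompact Θ)
    (Φ : Set (Euc q → ℝ))
    (hΦ : LinIndepDomain Θ Φ (2 * (k - k0 + 1) - 1) k0 k) :
    ∀ G0 : Euc q →₀ ℝ, MixE Θ k0 G0 →
      ∃ r > (0:ℝ), ∃ c > (0:ℝ), ∀ G H : Euc q →₀ ℝ,
        MixG Θ k G → MixG Θ k H → G ≠ H →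
        Wpow 1 G G0 ≤ r → Wpow 1 H G0 ≤ r →
        ENNReal.ofReal (c * Wpow ((2 * (k - k0 + 1) - 1 : ℕ) : ℝ) G H) ≤ phiDist Φ G H := by
  intro G₀ hG₀
  by_contra! hcon
  have hpos : ∀ n : ℕ, 0 < 1 / ((n : ℝ) + 1) := fun n => by positivity
  have hseq := fun n : ℕ => hcon _ (hpos n) _ (hpos n)
  choose G H hG hH _ hGW hHW hlt using hseq
  set p : ℕ := 2 * (k - k0 + 1) - 1 with hp
  have hp0 : p ≠ 0 := by omega
  have hWpos : ∀ n, 0 < Wpow (p : ℝ) (G n) (H n) := fun n =>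
    pos_of_mul_pos_right (ENNReal.ofReal_pos.1 (bot_le.trans_lt (hlt n))) (hpos n).le
  have hφ : ∀ φ ∈ Φ, ∀ n, |mixInt (G n) φ - mixInt (H n) φ| ≤
      1 / ((n : ℝ) + 1) * Wpow (p : ℝ) (G n) (H n) := fun φ hφ n => by
    have h : ENNReal.ofReal |mixInt (G n) φ - mixInt (H n) φ| ≤ phiDist Φ (G n) (H n) :=
      le_iSup₂ (f := fun φ (_ : φ ∈ Φ) => ENNReal.ofReal |mixInt (G n) φ - mixInt (H n) φ|) φ hφ
    exact (ENNReal.ofReal_le_ofReal_iff (mul_pos (hpos n) (hWpos n)).le).1 (h.trans (hlt n).le)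
  choose eG heG using fun n => exists_fin_image_eq (hG n).1.support_nonempty (hG n).2
  choose eH heH using fun n => exists_fin_image_eq (hH n).1.support_nonempty (hH n).2
  set x : ℕ → Fin k ⊕ Fin k → Euc q := fun n => Sum.elim (eG n) (eH n)
  have hGx : ∀ n, (G n).support ⊆ Finset.univ.image (x n) := fun n z hz => by
    rw [← heG n] at hz
    obtain ⟨j, -, rfl⟩ := Finset.mem_image.1 hz
    exact Finset.mem_image.2 ⟨Sum.inl j, Finset.mem_univ _, rfl⟩
  have hHx : ∀ n, (H n).support ⊆ Finset.univ.image (x n) := fun n z hz => by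
    rw [← heH n] at hz
    obtain ⟨j, -, rfl⟩ := Finset.mem_image.1 hz
    exact Finset.mem_image.2 ⟨Sum.inr j, Finset.mem_univ _, rfl⟩
  have hxΘ : ∀ n j, x n j ∈ Θ := by
    rintro n (j | j)
    · exact (hG n).1.2.2 (Finset.mem_coe.2 (heG n ▸ Finset.mem_image_of_mem _ (Finset.mem_univ j)))
    · exact (hH n).1.2.2 (Finset.mem_coe.2 (heH n ▸ Finset.mem_image_of_mem _ (Finset.mem_univ j)))
  set 𝒰 : Ultrafilter ℕ := Filter.hyperfilter ℕ
  have h𝒰 : (𝒰 : Filter ℕ) ≤ Filter.atTop := Nat.hyperfilter_le_atTop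
  have hy : ∀ j, ∃ y ∈ Θ, Filter.Tendsto (fun n => x n j) 𝒰 (nhds y) := fun j =>
    hΘ.ultrafilter_le_nhds (𝒰.map fun n => x n j) (Filter.le_principal_iff.2
      (Filter.mem_map.2 (Filter.Eventually.of_forall fun n => hxΘ n j)))
  choose y hyΘ hy using hy
  set T := Finset.univ.image y
  have hyT : ∀ j, y j ∈ T := fun j => Finset.mem_image_of_mem _ (Finset.mem_univ j)
  have hTΘ : ∀ τ ∈ T, τ ∈ Θ := fun τ hτ => by
    obtain ⟨j, -, rfl⟩ := Finset.mem_image.1 hτ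
    exact hyΘ j
  set m : Euc q → ℕ := fun τ => (Finset.univ.filter fun j => y j = τ).card
  obtain ⟨hc1, hc2, hm1, hmp, hmsum⟩ := multiplicity_bounds (y := y) (A := G₀.support) (m := m)
    (fun s hs => exists_tendsto_atom hG₀.1 h𝒰 (fun n => (hG n).1) hGW heG
      (y := fun j => y (Sum.inl j)) (fun j => hy (Sum.inl j)) hs)
    (fun s hs => exists_tendsto_atom hG₀.1 h𝒰 (fun n => (hH n).1) hHW heH
      (y := fun j => y (Sum.inr j)) (fun j => hy (Sum.inr j)) hs) fun τ => rfl
  rw [hG₀.2] at hc1 hc2 hmp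
  have hmp' : ∀ τ ∈ T, m τ ≤ p + 1 := fun τ hτ => (hmp τ hτ).trans (by omega)
  set S : ℕ → Euc q → Finset (Euc q) :=
    fun n τ => (Finset.univ.filter fun j => y j = τ).image (x n) with hS
  have hSmem : ∀ n τ z, z ∈ S n τ ↔ ∃ j, y j = τ ∧ x n j = z := fun n τ z => by simp [hS]
  have hSU : ∀ n, T.biUnion (S n) = Finset.univ.image (x n) := fun n => by
    ext z
    simp only [Finset.mem_biUnion, hSmem, Finset.mem_image, Finset.mem_univ, true_and]
    constructor
    · rintro ⟨τ, -, j, -, h⟩; exact ⟨j, h⟩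
    · rintro ⟨j, h⟩; exact ⟨y j, hyT j, j, rfl, h⟩
  have hcard : ∀ n, ∀ τ ∈ T, (S n τ).card ≤ m τ := fun n τ _ => Finset.card_image_le
  have hball : ∀ δ > 0, ∀ᶠ n in (𝒰 : Filter ℕ), ∀ τ ∈ T, ∀ z ∈ S n τ, z ∈ Metric.ball τ δ := by
    intro δ hδ
    have h : ∀ᶠ n in (𝒰 : Filter ℕ), ∀ j, x n j ∈ Metric.ball (y j) δ :=
      Filter.eventually_all.2 fun j => hy j (Metric.ball_mem_nhds _ hδ)
    refine h.mono fun n hn τ _ z hz => ?_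
    obtain ⟨j, rfl, rfl⟩ := (hSmem n τ z).1 hz
    exact hn j
  have hdisj : ∀ᶠ n in (𝒰 : Filter ℕ), (T : Set (Euc q)).PairwiseDisjoint (S n) := by
    have h : ∀ᶠ n in (𝒰 : Filter ℕ), ∀ j j', y j ≠ y j' → x n j ≠ x n j' :=
      Filter.eventually_all.2 fun j => Filter.eventually_all.2 fun j' => by
        by_cases hjj : y j = y j'
        · exact Filter.Eventually.of_forall fun n hne => (hne hjj).elim
        · exact (((hy j).sub (hy j')).eventually_ne (sub_ne_zero.2 hjj)).mono fun n hn _ =>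
            sub_ne_zero.1 hn
    refine h.mono fun n hn τ _ τ' _ hne => Finset.disjoint_left.2 fun z hz hz' => ?_
    obtain ⟨j, rfl, rfl⟩ := (hSmem n τ z).1 hz
    obtain ⟨j', rfl, hj'⟩ := (hSmem n τ' _).1 hz'
    exact hn j j' hne hj'.symm
  obtain ⟨D, hD⟩ := Metric.isBounded_iff.1 hΘ.isBounded
  obtain ⟨C, hC, hWC⟩ := exists_Wpow_le_moments hp0 (le_max_right D 1) T hmp'
  set w : ℕ → Euc q → ℝ := fun n z => G n z - H n z
  set N : ℕ → ℝ := fun n => ∑ τ ∈ T, ∑ α ∈ multiIdx q (m τ - 1),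
    |∑ z ∈ S n τ, w n z * shiftedMonomial τ α z|
  have hW : ∀ᶠ n in (𝒰 : Filter ℕ), Wpow (p : ℝ) (G n) (H n) ≤ C * N n := by
    filter_upwards [hball 1 one_pos, hdisj] with n hn1 hn2
    refine hWC (S n) (G n) (H n) (hcard n) hn2 (fun τ hτ z hz i => ?_) ?_
      (hSU n ▸ hGx n) (hSU n ▸ hHx n) (hG n).1.nonneg (hH n).1.nonneg
      ((hG n).1.sum_sub_eq_zero (hH n).1 (hSU n ▸ hGx n) (hSU n ▸ hHx n)) _
      (Finset.sum_nonneg fun τ _ => Finset.sum_nonneg fun α _ => abs_nonneg _) ?_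
    · have h := hn1 τ hτ z hz
      rw [mem_ball_iff_norm] at h
      exact (PiLp.norm_apply_le (z - τ) i).trans h.le
    · rw [hSU n]
      intro a ha b hb
      obtain ⟨j, -, rfl⟩ := Finset.mem_image.1 ha
      obtain ⟨j', -, rfl⟩ := Finset.mem_image.1 hb
      exact (hD (hxΘ n j) (hxΘ n j')).trans (le_max_left _ _)
    · intro τ hτ α hα
      refine le_trans ?_ (Finset.single_le_sum (fun τ _ =>
        Finset.sum_nonneg fun α _ => abs_nonneg (∑ z ∈ S n τ, w n z * shiftedMonomial τ α z)) hτ)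
      exact Finset.single_le_sum (f := fun α => |∑ z ∈ S n τ, w n z * shiftedMonomial τ α z|)
        (fun α _ => abs_nonneg _) (mem_multiIdx.2 hα)
  have hNpos : ∀ᶠ n in (𝒰 : Filter ℕ), 0 < N n :=
    hW.mono fun n hn => pos_of_mul_pos_right ((hWpos n).trans_le hn) hC
  obtain ⟨b, hb1, hbΦ, hblim⟩ := exists_moment_limit hmp' hm1 hcard hball (fun n => rfl) hNpos
    (Φ := Φ) (fun φ hφ => by
      obtain ⟨U, hU, hΘU, hφU⟩ := hΦ.1 φ hφ
      exact ⟨U, hU, fun τ hτ => hΘU (hTΘ τ hτ), hφU⟩)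
    (ε := fun n => 1 / ((n : ℝ) + 1) * C)
    (by
      have := (tendsto_one_div_add_atTop_nhds_zero_nat (𝕜 := ℝ)).mul_const C
      rw [zero_mul] at this
      exact this.mono_left h𝒰)
    (fun φ hφΦ => by
      filter_upwards [hW, hdisj] with n hn1 hn2
      rw [← Finset.sum_biUnion hn2, ← mixInt_sub_mixInt (hSU n ▸ hGx n) (hSU n ▸ hHx n), mul_assoc]
      exact (hφ φ hφΦ n).trans (mul_le_mul_of_nonneg_left hn1 (hpos n).le))
  have h0mem : ∀ τ ∈ T, (0 : Fin q → ℕ) ∈ multiIdx q (m τ - 1) := fun τ _ =>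
    mem_multiIdx.2 (by simp)
  have hb0 : ∑ τ ∈ T, b τ 0 = 0 := by
    refine tendsto_nhds_unique
      (tendsto_finsetSum T fun τ hτ => hblim τ hτ 0 (h0mem τ hτ)) ?_
    refine tendsto_const_nhds.congr' (hdisj.mono fun n hn => ?_)
    simp only [shiftedMonomial_zero, mul_one]
    rw [← Finset.sum_div, ← Finset.sum_biUnion hn,
      (hG n).1.sum_sub_eq_zero (hH n).1 (hSU n ▸ hGx n) (hSU n ▸ hHx n), zero_div]
  have hzero := hΦ.eq_zero_of_finset hTΘ hc1 hc2 hm1 hmp' (by rw [hmsum]; omega) hmsum.le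
    (b := fun τ α => b τ α / (∏ i, ((α i).factorial : ℝ))) hbΦ (by simpa using hb0)
  rw [Finset.sum_eq_zero fun τ hτ => Finset.sum_eq_zero fun α hα => ?_] at hb1
  · exact zero_ne_one hb1
  · rcases div_eq_zero_iff.1 (hzero τ hτ α hα) with h | h
    · rw [h, abs_zero]
    · exact absurd h (Finset.prod_ne_zero_iff.2 fun i _ =>
        Nat.cast_ne_zero.2 (Nat.factorial_ne_zero _))

end
end
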